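/- arXiv:2506.17426 — 2 statements merged into one kernel-verified Lean document; each statement's English description precedes it below -/
import Mathlib

section
/- Let Ω = Ω_{π/2} be the quarter-plane sector, let φ ∈ C_0^∞(ℝ²), and let φ*_Ω denote the dual symbol of φ_Ω := 1_Ω φ. Then φ*_Ω ∈ C^∞(ℝ²) and for all m, n = 0,1,2,…: |∂_x^m ∂_ξ^n φ*_Ω(x,ξ)| ≲ ⟨x⟩^{−1−m} ⟨ξ⟩^{−1−n}. Moreover, for any fixed ζ ∈ C^∞(ℝ) with ζ(x) = 1 for |x| ≥ 2 and ζ(x) = 0 for |x| < 1, one has φ*_Ω = b₀ + b₁, where b₀(x,ξ) = (4π)^{−1} φ(0,0) · (ζ(x)/x) · (ζ(ξ)/ξ) and |∂_x^m ∂_ξ^n b₁(x,ξ)| ≲ ⟨x⟩^{−1−m} ⟨ξ⟩^{−2−n} + ⟨x⟩^{−2−m} ⟨ξ⟩^{−1−n} for all m, n = 0,1,2,…. -/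
open MeasureTheory Filter Complex
open scoped ENNReal

noncomputable section

/-- the argument of a complex number, taken in `[0, 2π)` -/
def arg2pi (z : ℂ) : ℝ := if 0 ≤ z.arg then z.arg else z.arg + 2 * Real.pi

/-- the open sector `Ω_θ = {(x,ξ) : 0 < arg (x + iξ) < θ}` in the phase plane -/
def sector (θ : ℝ) : Set (ℝ × ℝ) :=
  {p | 0 < arg2pi (p.1 + p.2 * Complex.I) ∧ arg2pi (p.1 + p.2 * Complex.I) < θ}

/-- the Fourier transform `(F a)(η, y) = (2π)^{-1} ∬ e^{-i(yξ + ηx)} a(x,ξ) dξ dx` (`d = 1`) -/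
def Ftrans1 (a : ℝ × ℝ → ℂ) (p : ℝ × ℝ) : ℂ :=
  ((2 * Real.pi : ℝ)⁻¹ : ℝ) *
    ∫ x : ℝ, ∫ ξ : ℝ, Complex.exp (-Complex.I * ((p.2 * ξ + p.1 * x : ℝ) : ℂ)) * a (x, ξ)

/-- the dual symbol `a*(x,ξ) = 2 (F a)(2ξ, -2x)` (`d = 1`) -/
def dualSymb1 (a : ℝ × ℝ → ℂ) (τ : ℝ × ℝ) : ℂ :=
  2 * Ftrans1 a (2 * τ.2, -(2 * τ.1))

/-- the mixed partial derivative `∂_x^m ∂_ξ^n b(x, ξ)` -/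
def pdxi (m n : ℕ) (b : ℝ × ℝ → ℂ) (x ξ : ℝ) : ℂ :=
  iteratedDeriv m (fun x' => iteratedDeriv n (fun ξ' => b (x', ξ')) ξ) x

/-- the Japanese bracket power `⟨x⟩^{-s}` -/
def jbr (s x : ℝ) : ℝ := ((1 + x ^ 2) : ℝ) ^ (-s / 2)

/-- Smooth compactly supported complex-valued functions on the plane. -/
structure IsTestFun (φ : ℝ × ℝ → ℂ) : Prop where
  smooth : ContDiff ℝ (⊤ : ℕ∞) φ
  supp : HasCompactSupport φ

/-- The derivative in the second variable. -/
def partialSnd (φ : ℝ × ℝ → ℂ) (p : ℝ × ℝ) : ℂ := fderiv ℝ φ p (0, 1)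

/-- The half-line oscillatory integral `∫_{t > 0} e^{ict} h(t) dt`. -/
def halfLineInt (c : ℝ) (h : ℝ → ℂ) : ℂ :=
  ∫ t in Set.Ioi (0 : ℝ), Complex.exp (Complex.I * ((c * t : ℝ) : ℂ)) * h t

/-- The quarter-plane oscillatory integral `∬_{s, t > 0} e^{i(cs + dt)} φ(s, t) ds dt`. -/
def quarterInt (c d : ℝ) (φ : ℝ × ℝ → ℂ) : ℂ :=
  ∫ p in Set.Ioi (0 : ℝ) ×ˢ Set.Ioi (0 : ℝ),
    Complex.exp (Complex.I * ((c * p.1 + d * p.2 : ℝ) : ℂ)) * φ p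

lemma norm_exp_I_mul_ofReal_eq_one (r : ℝ) : ‖Complex.exp (Complex.I * (r : ℂ))‖ = 1 := by
  rw [mul_comm, Complex.norm_exp_ofReal_mul_I]

lemma contDiff_exp_I_mul_ofReal {E : Type*} [NormedAddCommGroup E] [NormedSpace ℝ E] {g : E → ℝ}
    (hg : ContDiff ℝ (⊤ : ℕ∞) g) :
    ContDiff ℝ (⊤ : ℕ∞) fun x => Complex.exp (Complex.I * ((g x : ℝ) : ℂ)) :=
  (contDiff_const.mul (Complex.ofRealCLM.contDiff.comp hg)).cexp

namespace IsTestFun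

variable {φ : ℝ × ℝ → ℂ}

lemma mul_left (hφ : IsTestFun φ) {g : ℝ × ℝ → ℂ} (hg : ContDiff ℝ (⊤ : ℕ∞) g) :
    IsTestFun (fun p => g p * φ p) :=
  ⟨hg.mul hφ.smooth, hφ.supp.mul_left⟩

lemma add {ψ : ℝ × ℝ → ℂ} (hφ : IsTestFun φ) (hψ : IsTestFun ψ) :
    IsTestFun (fun p => φ p + ψ p) :=
  ⟨hφ.smooth.add hψ.smooth, hφ.supp.add hψ.supp⟩

lemma swap (hφ : IsTestFun φ) : IsTestFun (φ ∘ Prod.swap) :=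
  ⟨hφ.smooth.comp (contDiff_snd.prodMk contDiff_fst),
    hφ.supp.comp_homeomorph (Homeomorph.prodComm ℝ ℝ)⟩

lemma partialSnd (hφ : IsTestFun φ) : IsTestFun (partialSnd φ) :=
  ⟨(hφ.smooth.fderiv_right (m := (⊤ : ℕ∞)) (by simp)).clm_apply contDiff_const,
    hφ.supp.fderiv_apply ℝ _⟩

lemma differentiable (hφ : IsTestFun φ) : Differentiable ℝ φ :=
  hφ.smooth.differentiable (by simp)

lemma integrable (hφ : IsTestFun φ) : Integrable φ :=
  hφ.smooth.continuous.integrable_of_hasCompactSupport hφ.supp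

lemma hasDerivAt_snd (hφ : IsTestFun φ) (s t : ℝ) :
    HasDerivAt (fun t => φ (s, t)) (_root_.partialSnd φ (s, t)) t := by
  have h := (hφ.differentiable (s, t)).hasFDerivAt
  exact h.comp_hasDerivAt t ((hasDerivAt_const t s).prodMk (hasDerivAt_id t))

lemma slice_smooth (hφ : IsTestFun φ) (s : ℝ) : ContDiff ℝ (⊤ : ℕ∞) (fun t => φ (s, t)) :=
  hφ.smooth.comp (contDiff_const.prodMk contDiff_id)

lemma slice_supp (hφ : IsTestFun φ) (s : ℝ) : HasCompactSupport (fun t => φ (s, t)) := by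
  have h := hφ.supp.isCompact.image continuous_snd
  refine HasCompactSupport.intro h fun t ht => ?_
  by_contra hne
  exact ht ⟨(s, t), subset_tsupport _ hne, rfl⟩

lemma slice_deriv (hφ : IsTestFun φ) (s : ℝ) :
    deriv (fun t => φ (s, t)) = fun t => _root_.partialSnd φ (s, t) :=
  funext fun t => (hφ.hasDerivAt_snd s t).deriv

lemma integrand_integrable (hφ : IsTestFun φ) (c d : ℝ) :
    Integrable (fun p : ℝ × ℝ =>
      Complex.exp (Complex.I * ((c * p.1 + d * p.2 : ℝ) : ℂ)) * φ p) :=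
  (hφ.mul_left (g := fun p : ℝ × ℝ => Complex.exp (Complex.I * ((c * p.1 + d * p.2 : ℝ) : ℂ)))
    (contDiff_exp_I_mul_ofReal
      ((contDiff_const.mul contDiff_fst).add (contDiff_const.mul contDiff_snd)))).integrable

end IsTestFun

lemma quarterInt_eq_iterated {φ : ℝ × ℝ → ℂ} (hφ : IsTestFun φ) (c d : ℝ) :
    quarterInt c d φ = halfLineInt c fun s => halfLineInt d fun t => φ (s, t) := by
  unfold quarterInt halfLineInt
  rw [Measure.volume_eq_prod, setIntegral_prod _ (hφ.integrand_integrable c d).integrableOn]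
  congr 1
  ext s
  rw [← integral_const_mul]
  congr 1
  ext t
  rw [← mul_assoc, ← Complex.exp_add]
  congr 2
  push_cast
  ring

lemma quarterInt_swap (φ : ℝ × ℝ → ℂ) (c d : ℝ) :
    quarterInt c d (φ ∘ Prod.swap) = quarterInt d c φ := by
  unfold quarterInt
  rw [Measure.volume_eq_prod, ← setIntegral_prod_swap]
  congr 1
  ext p
  simp [add_comm]

lemma mul_halfLineInt {h : ℝ → ℂ} (hh : ContDiff ℝ (⊤ : ℕ∞) h) (hs : HasCompactSupport h)
    (c : ℝ) :
    Complex.I * c * halfLineInt c h = -h 0 - halfLineInt c (deriv h) := by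
  have he : ContDiff ℝ (⊤ : ℕ∞) fun t : ℝ => Complex.exp (Complex.I * ((c * t : ℝ) : ℂ)) :=
    contDiff_exp_I_mul_ofReal (contDiff_const.mul contDiff_id)
  have hd : deriv (fun t : ℝ => Complex.exp (Complex.I * ((c * t : ℝ) : ℂ)) * h t) = fun t =>
      Complex.I * c * (Complex.exp (Complex.I * ((c * t : ℝ) : ℂ)) * h t) +
        Complex.exp (Complex.I * ((c * t : ℝ) : ℂ)) * deriv h t := by
    ext t
    have h1 : HasDerivAt (fun t : ℝ => Complex.I * ((c * t : ℝ) : ℂ)) (Complex.I * c) t := by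
      have := (((hasDerivAt_id t).const_mul c).ofReal_comp).const_mul Complex.I
      simpa using this
    have h2 := (hh.differentiable (by simp) t).hasDerivAt
    refine (h1.cexp.mul h2).deriv.trans ?_
    ring
  have hi := HasCompactSupport.integral_Ioi_deriv_eq ((he.mul hh).of_le (by simp))
    (hs.mul_left (f := fun t : ℝ => Complex.exp (Complex.I * ((c * t : ℝ) : ℂ)))) 0
  have i1 : Integrable fun t : ℝ => Complex.exp (Complex.I * ((c * t : ℝ) : ℂ)) * h t :=
    (he.mul hh).continuous.integrable_of_hasCompactSupport hs.mul_left
  have i2 : Integrable fun t : ℝ => Complex.exp (Complex.I * ((c * t : ℝ) : ℂ)) * deriv h t :=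
    (he.continuous.mul (hh.continuous_deriv (by simp))).integrable_of_hasCompactSupport
      hs.deriv.mul_left
  rw [hd, integral_add (i1.const_mul _).integrableOn i2.integrableOn, integral_const_mul] at hi
  unfold halfLineInt
  simp only [mul_zero, ofReal_zero, Complex.exp_zero, one_mul] at hi
  linear_combination hi

lemma norm_halfLineInt_le (c : ℝ) (h : ℝ → ℂ) :
    ‖halfLineInt c h‖ ≤ ∫ t in Set.Ioi (0 : ℝ), ‖h t‖ :=
  (norm_integral_le_integral_norm _).trans_eq (by simp only [norm_mul, norm_exp_I_mul_ofReal_eq_one,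
    one_mul])

lemma norm_quarterInt_le (c d : ℝ) (φ : ℝ × ℝ → ℂ) :
    ‖quarterInt c d φ‖ ≤ ∫ p in Set.Ioi (0 : ℝ) ×ˢ Set.Ioi (0 : ℝ), ‖φ p‖ :=
  (norm_integral_le_integral_norm _).trans_eq (by simp only [norm_mul, norm_exp_I_mul_ofReal_eq_one,
    one_mul])

lemma mul_quarterInt_snd {φ : ℝ × ℝ → ℂ} (hφ : IsTestFun φ) (c d : ℝ) :
    Complex.I * d * quarterInt c d φ =
      -halfLineInt c (fun s => φ (s, 0)) - quarterInt c d (partialSnd φ) := by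
  have i1 : Integrable fun s : ℝ => Complex.exp (Complex.I * ((c * s : ℝ) : ℂ)) * φ (s, 0) := by
    have h := hφ.swap.slice_supp 0
    refine Continuous.integrable_of_hasCompactSupport ?_ (HasCompactSupport.mul_left h)
    have := (hφ.swap.slice_smooth 0).continuous
    exact (contDiff_exp_I_mul_ofReal (contDiff_const.mul contDiff_id)).continuous.mul this
  have i2 : IntegrableOn (fun s : ℝ => Complex.exp (Complex.I * ((c * s : ℝ) : ℂ)) *
      halfLineInt d fun t => partialSnd φ (s, t)) (Set.Ioi 0) := by
    have h := (hφ.partialSnd.integrand_integrable c d).integrableOn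
      (s := Set.Ioi (0 : ℝ) ×ˢ Set.Ioi (0 : ℝ))
    rw [IntegrableOn, Measure.volume_eq_prod, ← Measure.prod_restrict] at h
    refine h.integral_prod_left.congr (Eventually.of_forall fun s => ?_)
    simp only [halfLineInt]
    rw [← integral_const_mul]
    congr 1
    ext t
    rw [← mul_assoc, ← Complex.exp_add]
    congr 2
    push_cast
    ring
  rw [quarterInt_eq_iterated hφ, quarterInt_eq_iterated hφ.partialSnd]
  conv_lhs => rw [halfLineInt]
  rw [← integral_const_mul]
  have hpt : ∀ s : ℝ, Complex.I * d * (Complex.exp (Complex.I * ((c * s : ℝ) : ℂ)) *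
      halfLineInt d fun t => φ (s, t)) = -(Complex.exp (Complex.I * ((c * s : ℝ) : ℂ)) * φ (s, 0)) -
      Complex.exp (Complex.I * ((c * s : ℝ) : ℂ)) * halfLineInt d fun t => partialSnd φ (s, t) := by
    intro s
    have := mul_halfLineInt (hφ.slice_smooth s) (hφ.slice_supp s) d
    rw [hφ.slice_deriv] at this
    linear_combination Complex.exp (Complex.I * ((c * s : ℝ) : ℂ)) * this
  rw [integral_congr_ae (Eventually.of_forall hpt)]
  refine (integral_sub i1.neg.integrableOn i2).trans ?_
  simp only [Pi.neg_apply, integral_neg]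
  rfl

lemma hasDerivAt_quarterInt_snd {φ : ℝ × ℝ → ℂ} (hφ : IsTestFun φ) (c d : ℝ) :
    HasDerivAt (fun d => quarterInt c d φ)
      (quarterInt c d fun p => Complex.I * p.2 * φ p) d := by
  have hφ' : IsTestFun fun p => Complex.I * p.2 * φ p :=
    hφ.mul_left (contDiff_const.mul (Complex.ofRealCLM.contDiff.comp contDiff_snd))
  refine (hasDerivAt_integral_of_dominated_loc_of_deriv_le (s := Set.univ)
    (F := fun x p => Complex.exp (Complex.I * ((c * p.1 + x * p.2 : ℝ) : ℂ)) * φ p)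
    (F' := fun x p =>
      Complex.exp (Complex.I * ((c * p.1 + x * p.2 : ℝ) : ℂ)) * (Complex.I * p.2 * φ p))
    (bound := fun p => ‖Complex.I * p.2 * φ p‖) univ_mem
    (Eventually.of_forall fun x =>
      (hφ.integrand_integrable c x).integrableOn.aestronglyMeasurable)
    (hφ.integrand_integrable c d).integrableOn
    (hφ'.integrand_integrable c d).integrableOn.aestronglyMeasurable
    (Eventually.of_forall fun p x _ => ?_) hφ'.integrable.norm.integrableOn
    (Eventually.of_forall fun p x _ => ?_)).2
  · rw [norm_mul, norm_exp_I_mul_ofReal_eq_one, one_mul]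
  · have h1 : HasDerivAt (fun x : ℝ => Complex.I * ((c * p.1 + x * p.2 : ℝ) : ℂ))
        (Complex.I * p.2) x := by
      have := ((((hasDerivAt_id x).mul_const p.2).const_add (c * p.1)).ofReal_comp).const_mul
        Complex.I
      simpa using this
    refine (h1.cexp.mul_const (φ p)).congr_deriv ?_
    ring

lemma hasDerivAt_quarterInt_fst {φ : ℝ × ℝ → ℂ} (hφ : IsTestFun φ) (c d : ℝ) :
    HasDerivAt (fun c => quarterInt c d φ)
      (quarterInt c d fun p => Complex.I * p.1 * φ p) c := by
  have h := hasDerivAt_quarterInt_snd hφ.swap d c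
  simp only [quarterInt_swap] at h
  rwa [← quarterInt_swap] at h

lemma mul_quarterInt_fst {φ : ℝ × ℝ → ℂ} (hφ : IsTestFun φ) (c d : ℝ) :
    Complex.I * c * quarterInt c d φ = -halfLineInt d (fun t => φ (0, t)) -
      quarterInt c d (partialSnd (φ ∘ Prod.swap) ∘ Prod.swap) := by
  rw [← quarterInt_swap φ, quarterInt_swap (partialSnd _), mul_quarterInt_snd hφ.swap]
  rfl

lemma IsTestFun.I_mul_fst_pow_mul {φ : ℝ × ℝ → ℂ} (hφ : IsTestFun φ) (n : ℕ) :
    IsTestFun fun p => (Complex.I * p.1) ^ n * φ p :=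
  hφ.mul_left ((contDiff_const.mul (Complex.ofRealCLM.contDiff.comp contDiff_fst)).pow n)

lemma IsTestFun.I_mul_snd_pow_mul {φ : ℝ × ℝ → ℂ} (hφ : IsTestFun φ) (n : ℕ) :
    IsTestFun fun p => (Complex.I * p.2) ^ n * φ p :=
  hφ.mul_left ((contDiff_const.mul (Complex.ofRealCLM.contDiff.comp contDiff_snd)).pow n)

lemma pow_mul_quarterInt_snd (m : ℕ) : ∀ {φ : ℝ × ℝ → ℂ}, IsTestFun φ →
    ∃ ψ : ℝ × ℝ → ℂ, IsTestFun ψ ∧ ψ (0, 0) = (-1) ^ m * (m.factorial : ℂ) * φ (0, 0) ∧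
      ∀ (n : ℕ) (c d : ℝ),
        (d : ℂ) ^ m * quarterInt c d
          (fun p => (Complex.I * p.1) ^ n * ((Complex.I * p.2) ^ m * φ p)) =
        quarterInt c d fun p => (Complex.I * p.1) ^ n * ψ p := by
  induction m with
  | zero => exact fun {φ} hφ => ⟨φ, hφ, by simp, by simp⟩
  | succ m ih =>
    intro φ hφ
    have hφ' : IsTestFun fun p => (-(m + 1 : ℂ)) * φ p + (-(p.2 : ℂ)) * partialSnd φ p :=
      (hφ.mul_left contDiff_const).add
        (hφ.partialSnd.mul_left (Complex.ofRealCLM.contDiff.comp contDiff_snd).neg)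
    obtain ⟨ψ, hψ, hψ0, h⟩ := ih hφ'
    refine ⟨ψ, hψ, ?_, fun n c d => ?_⟩
    · rw [hψ0, Nat.factorial_succ]
      push_cast
      ring
    rw [← h]
    have hχ : IsTestFun fun p => (Complex.I * p.1) ^ n * ((Complex.I * p.2) ^ (m + 1) * φ p) :=
      (hφ.I_mul_snd_pow_mul (m + 1)).I_mul_fst_pow_mul n
    have hd : partialSnd (fun p => (Complex.I * p.1) ^ n * ((Complex.I * p.2) ^ (m + 1) * φ p)) =
        fun p => -Complex.I * ((Complex.I * p.1) ^ n * ((Complex.I * p.2) ^ m *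
          ((-(m + 1 : ℂ)) * φ p + (-(p.2 : ℂ)) * partialSnd φ p))) := by
      ext ⟨s, t⟩
      refine (hχ.hasDerivAt_snd s t).unique ?_
      have h1 : HasDerivAt (fun t : ℝ => Complex.I * (t : ℂ)) Complex.I t := by
        simpa using ((hasDerivAt_id t).ofReal_comp).const_mul Complex.I
      refine (((h1.pow (m + 1)).mul (hφ.hasDerivAt_snd s t)).const_mul
        ((Complex.I * (s : ℂ)) ^ n)).congr_deriv ?_
      simp only [Nat.add_sub_cancel, Pi.pow_apply]
      push_cast
      ring
    have hi := mul_quarterInt_snd hχ c d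
    have h0 : halfLineInt c (fun s => (Complex.I * ((s, (0 : ℝ)) : ℝ × ℝ).1) ^ n *
        ((Complex.I * ((s, (0 : ℝ)) : ℝ × ℝ).2) ^ (m + 1) * φ (s, 0))) = 0 := by
      simp [halfLineInt]
    have hc : ∀ f : ℝ × ℝ → ℂ, quarterInt c d (fun p => -Complex.I * f p) =
        -Complex.I * quarterInt c d f := by
      intro f
      unfold quarterInt
      rw [← integral_const_mul]
      congr 1
      ext p
      ring
    rw [h0, hd, hc] at hi
    have hi' : (d : ℂ) * quarterInt c d
          (fun p => (Complex.I * p.1) ^ n * ((Complex.I * p.2) ^ (m + 1) * φ p)) =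
        quarterInt c d fun p => (Complex.I * p.1) ^ n * ((Complex.I * p.2) ^ m *
          ((-(m + 1 : ℂ)) * φ p + (-(p.2 : ℂ)) * partialSnd φ p)) := by
      refine mul_left_cancel₀ Complex.I_ne_zero ?_
      linear_combination hi
    rw [← hi', pow_succ]
    ring

lemma pow_mul_quarterInt_fst (n : ℕ) {φ : ℝ × ℝ → ℂ} (hφ : IsTestFun φ) :
    ∃ ψ : ℝ × ℝ → ℂ, IsTestFun ψ ∧ ψ (0, 0) = (-1) ^ n * (n.factorial : ℂ) * φ (0, 0) ∧
      ∀ c d : ℝ, (c : ℂ) ^ n * quarterInt c d (fun p => (Complex.I * p.1) ^ n * φ p) =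
        quarterInt c d ψ := by
  obtain ⟨ψ, hψ, hψ0, h⟩ := pow_mul_quarterInt_snd n hφ.swap
  refine ⟨ψ ∘ Prod.swap, hψ.swap, by simpa using hψ0, fun c d => ?_⟩
  have := h 0 d c
  simp only [pow_zero, one_mul] at this
  rw [quarterInt_swap, ← this, ← quarterInt_swap]
  rfl

lemma exists_bound_halfLineInt {h : ℝ → ℂ} (hh : ContDiff ℝ (⊤ : ℕ∞) h)
    (hs : HasCompactSupport h) : ∃ C : ℝ, ∀ c : ℝ, |c| * ‖halfLineInt c h‖ ≤ C := by
  refine ⟨‖h 0‖ + ∫ t in Set.Ioi (0 : ℝ), ‖deriv h t‖, fun c => ?_⟩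
  have e : |c| * ‖halfLineInt c h‖ = ‖Complex.I * c * halfLineInt c h‖ := by simp
  rw [e, mul_halfLineInt hh hs]
  refine (norm_sub_le _ _).trans ?_
  rw [norm_neg]
  gcongr
  exact norm_halfLineInt_le _ _

lemma exists_bound_fst_quarterInt {φ : ℝ × ℝ → ℂ} (hφ : IsTestFun φ) :
    ∃ C : ℝ, ∀ c d : ℝ, |c| * ‖quarterInt c d φ‖ ≤ C := by
  refine ⟨(∫ t in Set.Ioi (0 : ℝ), ‖φ (0, t)‖) + ∫ p in Set.Ioi (0 : ℝ) ×ˢ Set.Ioi (0 : ℝ),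
    ‖(partialSnd (φ ∘ Prod.swap) ∘ Prod.swap) p‖, fun c d => ?_⟩
  have e : |c| * ‖quarterInt c d φ‖ = ‖Complex.I * c * quarterInt c d φ‖ := by simp
  rw [e, mul_quarterInt_fst hφ]
  refine (norm_sub_le _ _).trans ?_
  rw [norm_neg]
  exact add_le_add (norm_halfLineInt_le _ _) (norm_quarterInt_le _ _ _)

lemma exists_bound_snd_quarterInt {φ : ℝ × ℝ → ℂ} (hφ : IsTestFun φ) :
    ∃ C : ℝ, ∀ c d : ℝ, |d| * ‖quarterInt c d φ‖ ≤ C := by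
  obtain ⟨C, hC⟩ := exists_bound_fst_quarterInt hφ.swap
  exact ⟨C, fun c d => by simpa only [quarterInt_swap] using hC d c⟩

lemma mul_mul_quarterInt {φ : ℝ × ℝ → ℂ} (hφ : IsTestFun φ) (c d : ℝ) :
    -((c : ℂ) * d * quarterInt c d φ) = φ (0, 0) +
      (halfLineInt c (deriv fun s => φ (s, 0)) + halfLineInt d (fun t => partialSnd φ (0, t)) +
        quarterInt c d (partialSnd (partialSnd φ ∘ Prod.swap) ∘ Prod.swap)) := by
  have h1 := mul_quarterInt_snd hφ c d
  have h2 := mul_quarterInt_fst hφ.partialSnd c d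
  have h3 := mul_halfLineInt (hφ.swap.slice_smooth 0) (hφ.swap.slice_supp 0) c
  simp only [Function.comp, Prod.swap] at h3 ⊢ h2
  linear_combination Complex.I * c * h1 - h2 - h3 - (c : ℂ) * d * quarterInt c d φ * Complex.I_sq

lemma exists_bound_quarterInt_remainder {φ : ℝ × ℝ → ℂ} (hφ : IsTestFun φ) :
    ∃ C : ℝ, ∀ c d : ℝ,
      |c| * |d| * ‖(c : ℂ) * d * quarterInt c d φ + φ (0, 0)‖ ≤ C * (|c| + |d|) := by
  have hs : ContDiff ℝ (⊤ : ℕ∞) (deriv fun s => φ (s, 0)) :=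
    ContDiff.deriv' (n := (⊤ : ℕ∞)) (hφ.swap.slice_smooth 0)
  obtain ⟨C₁, h₁⟩ := exists_bound_halfLineInt hs (hφ.swap.slice_supp 0).deriv
  obtain ⟨C₂, h₂⟩ := exists_bound_halfLineInt (hφ.partialSnd.slice_smooth 0)
    (hφ.partialSnd.slice_supp 0)
  obtain ⟨C₃, h₃⟩ := exists_bound_fst_quarterInt hφ.partialSnd.swap.partialSnd.swap
  have p₁ : 0 ≤ C₁ := by simpa using h₁ 0
  have p₂ : 0 ≤ C₂ := by simpa using h₂ 0
  have p₃ : 0 ≤ C₃ := by simpa using h₃ 0 0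
  refine ⟨C₁ + C₂ + C₃, fun c d => ?_⟩
  have e := mul_mul_quarterInt hφ c d
  set A := halfLineInt c (deriv fun s => φ (s, 0))
  set B := halfLineInt d fun t => partialSnd φ (0, t)
  set D := quarterInt c d (partialSnd (partialSnd φ ∘ Prod.swap) ∘ Prod.swap)
  have e' : (c : ℂ) * d * quarterInt c d φ + φ (0, 0) = -(A + B + D) := by
    linear_combination -e
  rw [e', norm_neg]
  have hn : ‖A + B + D‖ ≤ ‖A‖ + ‖B‖ + ‖D‖ := norm_add₃_le
  have q₁ := mul_le_mul_of_nonneg_left (h₁ c) (abs_nonneg d)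
  have q₂ := mul_le_mul_of_nonneg_left (h₂ d) (abs_nonneg c)
  have q₃ := mul_le_mul_of_nonneg_left (h₃ c d) (abs_nonneg d)
  have hcd : 0 ≤ |c| * |d| := by positivity
  calc |c| * |d| * ‖A + B + D‖ ≤ |c| * |d| * (‖A‖ + ‖B‖ + ‖D‖) := by gcongr
    _ ≤ |d| * C₁ + |c| * C₂ + |d| * C₃ := by linarith
    _ ≤ (C₁ + C₂ + C₃) * (|c| + |d|) := by
      nlinarith [mul_nonneg p₁ (abs_nonneg c), mul_nonneg p₂ (abs_nonneg d),
        mul_nonneg p₃ (abs_nonneg c)]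

lemma contDiff_quarterInt {φ : ℝ × ℝ → ℂ} (hφ : IsTestFun φ) :
    ContDiff ℝ (⊤ : ℕ∞) fun p : ℝ × ℝ => quarterInt p.1 p.2 φ := by
  let L : ℝ × ℝ →L[ℝ] ℝ × ℝ →L[ℝ] ℝ := (-(2 * Real.pi)⁻¹ : ℝ) •
    ((ContinuousLinearMap.mul ℝ ℝ).bilinearComp (ContinuousLinearMap.fst ℝ ℝ ℝ)
        (ContinuousLinearMap.fst ℝ ℝ ℝ) +
      (ContinuousLinearMap.mul ℝ ℝ).bilinearComp (ContinuousLinearMap.snd ℝ ℝ ℝ)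
        (ContinuousLinearMap.snd ℝ ℝ ℝ))
  have hL : ∀ v w : ℝ × ℝ, L v w = -(2 * Real.pi)⁻¹ * (v.1 * w.1 + v.2 * w.2) :=
    fun v w => rfl
  have h := VectorFourier.contDiff_fourierIntegral (N := ⊤) (f := φ) (L := L)
    (μ := volume.restrict (Set.Ioi (0 : ℝ) ×ˢ Set.Ioi (0 : ℝ))) (fun n _ => by
      refine Integrable.integrableOn (μ := volume) ?_
      exact ((continuous_norm.pow n).mul hφ.smooth.continuous.norm).integrable_of_hasCompactSupport
        hφ.supp.norm.mul_left)
  convert! h using 2 with p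
  unfold quarterInt VectorFourier.fourierIntegral
  congr 1
  ext v
  rw [Circle.smul_def, Real.fourierChar_apply, smul_eq_mul]
  congr 2
  change _ = ((2 * Real.pi * -(L v p) : ℝ) : ℂ) * Complex.I
  rw [hL, mul_comm]
  congr 2
  have := Real.pi_ne_zero
  field_simp

lemma iteratedDeriv_quarterInt_fst {φ : ℝ × ℝ → ℂ} (hφ : IsTestFun φ) (a : ℂ) (α d : ℝ) (n : ℕ) :
    iteratedDeriv n (fun y : ℝ => a * quarterInt (α * y) d φ) =
      fun y : ℝ => a * (α : ℂ) ^ n *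
        quarterInt (α * y) d fun p => (Complex.I * p.1) ^ n * φ p := by
  induction n with
  | zero => simp
  | succ n ih =>
    rw [iteratedDeriv_succ, ih]
    ext y
    have h := ((hasDerivAt_quarterInt_fst (hφ.I_mul_fst_pow_mul n) (α * y) d).scomp y
      ((hasDerivAt_id y).const_mul α)).const_mul (a * (α : ℂ) ^ n)
    refine h.deriv.trans ?_
    rw [Complex.real_smul]
    simp only [pow_succ', mul_assoc, mul_one]
    ring

lemma iteratedDeriv_quarterInt_snd {φ : ℝ × ℝ → ℂ} (hφ : IsTestFun φ) (a : ℂ) (α c : ℝ) (n : ℕ) :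
    iteratedDeriv n (fun y : ℝ => a * quarterInt c (α * y) φ) =
      fun y : ℝ => a * (α : ℂ) ^ n *
        quarterInt c (α * y) fun p => (Complex.I * p.2) ^ n * φ p := by
  have h := iteratedDeriv_quarterInt_fst hφ.swap a α c n
  simp only [quarterInt_swap] at h
  rw [h]
  ext y
  rw [← quarterInt_swap _ c]
  rfl

lemma pdxi_quarterInt {φ : ℝ × ℝ → ℂ} (hφ : IsTestFun φ) (a : ℂ) (m n : ℕ) (x ξ : ℝ) :
    pdxi m n (fun p => a * quarterInt (-2 * p.2) (2 * p.1) φ) x ξ =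
      a * (-2) ^ n * 2 ^ m * quarterInt (-2 * ξ) (2 * x)
        fun p => (Complex.I * p.1) ^ n * ((Complex.I * p.2) ^ m * φ p) := by
  simp only [pdxi, iteratedDeriv_quarterInt_fst hφ,
    iteratedDeriv_quarterInt_snd (hφ.I_mul_fst_pow_mul n)]
  simp only [mul_left_comm]
  push_cast
  ring

/-- Weighted boundedness of the moments of a quarter-plane integral. -/
lemma exists_bound_quarterInt_moment {φ : ℝ × ℝ → ℂ} (hφ : IsTestFun φ) (m n : ℕ) :
    ∃ C : ℝ, ∀ c d : ℝ, ∀ N : ℝ, N = ‖quarterInt c d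
        fun p => (Complex.I * p.1) ^ n * ((Complex.I * p.2) ^ m * φ p)‖ →
      N ≤ C ∧ |c| ^ (n + 1) * N ≤ C ∧ |d| ^ (m + 1) * N ≤ C ∧
        |d| ^ (m + 1) * (|c| ^ (n + 1) * N) ≤ C := by
  have hΦ := (hφ.I_mul_snd_pow_mul m).I_mul_fst_pow_mul n
  obtain ⟨ψ₁, hψ₁, -, e₁⟩ := pow_mul_quarterInt_fst n (hφ.I_mul_snd_pow_mul m)
  obtain ⟨ψ₂, hψ₂, -, e₂⟩ := pow_mul_quarterInt_snd m hφ
  obtain ⟨ψ, hψ, -, e⟩ := pow_mul_quarterInt_fst n hψ₂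
  obtain ⟨C₁, h₁⟩ := exists_bound_fst_quarterInt hψ₁
  obtain ⟨C₂, h₂⟩ := exists_bound_snd_quarterInt (hψ₂.I_mul_fst_pow_mul n)
  obtain ⟨C, h⟩ := exists_bound_fst_quarterInt hψ.partialSnd
  obtain ⟨C', h'⟩ := exists_bound_halfLineInt (hψ.swap.slice_smooth 0) (hψ.swap.slice_supp 0)
  have b₀ := fun c d => norm_quarterInt_le c d
    fun p => (Complex.I * p.1) ^ n * ((Complex.I * p.2) ^ m * φ p)
  set C₀ := ∫ p in Set.Ioi (0 : ℝ) ×ˢ Set.Ioi (0 : ℝ),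
    ‖(Complex.I * p.1) ^ n * ((Complex.I * p.2) ^ m * φ p)‖
  have p₀ : 0 ≤ C₀ := (norm_nonneg _).trans (b₀ 0 0)
  have p₁ : 0 ≤ C₁ := by simpa using h₁ 0 0
  have p₂ : 0 ≤ C₂ := by simpa using h₂ 0 0
  have p : 0 ≤ C := by simpa using h 0 0
  have p' : 0 ≤ C' := by simpa using h' 0
  refine ⟨C₀ + C₁ + C₂ + C + C', fun c d N hN => ?_⟩
  have r₀ := b₀ c d
  have r₁ := h₁ c d
  have r₂ := h₂ c d
  rw [← e₁, norm_mul, norm_pow, Complex.norm_real, Real.norm_eq_abs, ← hN] at r₁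
  rw [← e₂, norm_mul, norm_pow, Complex.norm_real, Real.norm_eq_abs, ← hN] at r₂
  rw [← hN] at r₀
  have r : |d| * (|c| * ‖quarterInt c d ψ‖) ≤ C' + C := by
    have e : |d| * (|c| * ‖quarterInt c d ψ‖) =
        |c| * ‖Complex.I * d * quarterInt c d ψ‖ := by
      simp only [norm_mul, Complex.norm_I, Complex.norm_real, Real.norm_eq_abs]
      ring
    rw [e, mul_quarterInt_snd hψ]
    refine (mul_le_mul_of_nonneg_left (norm_sub_le _ _) (abs_nonneg c)).trans ?_
    rw [norm_neg, mul_add]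
    exact add_le_add (h' c) (h c d)
  rw [← e, ← e₂] at r
  simp only [norm_mul, norm_pow, Complex.norm_real, Real.norm_eq_abs] at r hN
  rw [← hN] at r
  refine ⟨by linarith, ?_, ?_, ?_⟩
  · rw [pow_succ']
    linarith
  · rw [pow_succ']
    linarith
  · calc _ = |d| * (|c| * (|c| ^ n * (|d| ^ m * N))) := by ring
      _ ≤ _ := r
      _ ≤ _ := by linarith

lemma exists_bound_quarterInt_moment_remainder {φ : ℝ × ℝ → ℂ} (hφ : IsTestFun φ) (m n : ℕ) :
    ∃ C : ℝ, ∀ c d : ℝ, |c| * |d| * ‖(c : ℂ) ^ (n + 1) * (d : ℂ) ^ (m + 1) * quarterInt c d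
        (fun p => (Complex.I * p.1) ^ n * ((Complex.I * p.2) ^ m * φ p)) +
        (-1) ^ m * m.factorial * ((-1) ^ n * n.factorial) * φ (0, 0)‖ ≤ C * (|c| + |d|) := by
  obtain ⟨ψ₂, hψ₂, z₂, e₂⟩ := pow_mul_quarterInt_snd m hφ
  obtain ⟨ψ, hψ, z, e⟩ := pow_mul_quarterInt_fst n hψ₂
  obtain ⟨C, h⟩ := exists_bound_quarterInt_remainder hψ
  refine ⟨C, fun c d => (le_of_eq ?_).trans (h c d)⟩
  rw [← e, ← e₂, z, z₂]
  congr 2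
  ring

/-- The Japanese bracket `⟨x⟩ = (1 + x²)^{1/2}`. -/
def bracket (x : ℝ) : ℝ := √(1 + x ^ 2)

lemma one_le_bracket (x : ℝ) : 1 ≤ bracket x := by
  rw [bracket, Real.one_le_sqrt]
  nlinarith [sq_nonneg x]

lemma bracket_pos (x : ℝ) : 0 < bracket x := one_pos.trans_le (one_le_bracket x)

lemma abs_le_bracket (x : ℝ) : |x| ≤ bracket x :=
  Real.abs_le_sqrt (by linarith)

lemma bracket_mono {x y : ℝ} (h : |x| ≤ |y|) : bracket x ≤ bracket y :=
  Real.sqrt_le_sqrt (by linarith [sq_le_sq.2 h])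

lemma bracket_le_two_mul {x r : ℝ} (hr : 1 ≤ r) (h : |x| ≤ r) : bracket x ≤ 2 * r := by
  refine Real.sqrt_le_iff.2 ⟨by linarith, ?_⟩
  have : x ^ 2 ≤ r ^ 2 := by
    rw [← sq_abs]
    gcongr
  nlinarith

lemma bracket_pow_mul_le {x N C : ℝ} {k : ℕ} (hN : 0 ≤ N) (h₁ : N ≤ C) (h₂ : |x| ^ k * N ≤ C) :
    bracket x ^ k * N ≤ 2 ^ k * C := by
  have hb := (bracket_pos x).le
  rcases le_total |x| 1 with h | h
  · calc bracket x ^ k * N ≤ (2 * 1) ^ k * N := by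
          gcongr
          exact bracket_le_two_mul le_rfl h
      _ ≤ 2 ^ k * C := by
          rw [mul_one]
          gcongr
  · calc bracket x ^ k * N ≤ (2 * |x|) ^ k * N := by
          gcongr
          exact bracket_le_two_mul h le_rfl
      _ = 2 ^ k * (|x| ^ k * N) := by rw [mul_pow, mul_assoc]
      _ ≤ 2 ^ k * C := by gcongr

lemma jbr_natCast (k : ℕ) (x : ℝ) : jbr k x = (bracket x ^ k)⁻¹ := by
  have h : (0 : ℝ) ≤ 1 + x ^ 2 := by positivity
  rw [jbr, bracket, Real.sqrt_eq_rpow, ← Real.rpow_mul_natCast h, ← Real.rpow_neg h]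
  congr 1
  ring

lemma jbr_one_add (m : ℕ) (x : ℝ) : jbr (1 + m) x = (bracket x ^ (m + 1))⁻¹ := by
  rw [← jbr_natCast]
  push_cast
  rw [add_comm]

lemma jbr_two_add (m : ℕ) (x : ℝ) : jbr (2 + m) x = (bracket x ^ (m + 2))⁻¹ := by
  rw [← jbr_natCast]
  push_cast
  rw [add_comm]

/-- The symbol estimate for a quarter-plane integral. -/
lemma exists_bound_bracket_pdxi_quarterInt {φ : ℝ × ℝ → ℂ} (hφ : IsTestFun φ) (a : ℂ) (m n : ℕ) :
    ∃ C : ℝ, ∀ x ξ : ℝ, bracket x ^ (m + 1) * (bracket ξ ^ (n + 1) *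
      ‖pdxi m n (fun p => a * quarterInt (-2 * p.2) (2 * p.1) φ) x ξ‖) ≤ C := by
  obtain ⟨C, hC⟩ := exists_bound_quarterInt_moment hφ m n
  refine ⟨‖a * (-2) ^ n * 2 ^ m‖ * (2 ^ (m + 1) * (2 ^ (n + 1) * C)), fun x ξ => ?_⟩
  rw [pdxi_quarterInt hφ, norm_mul]
  set N := ‖quarterInt (-2 * ξ) (2 * x)
    fun p => (Complex.I * p.1) ^ n * ((Complex.I * p.2) ^ m * φ p)‖ with hN
  obtain ⟨h₁, h₂, h₃, h₄⟩ := hC _ _ N hN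
  have hN0 : 0 ≤ N := norm_nonneg _
  have hx := bracket_mono (x := x) (y := 2 * x) (by rw [abs_mul]; norm_num; linarith [abs_nonneg x])
  have hξ := bracket_mono (x := ξ) (y := -2 * ξ)
    (by rw [abs_mul]; norm_num; linarith [abs_nonneg ξ])
  have hb := (bracket_pos x).le
  have hb' := (bracket_pos ξ).le
  have k₁ := bracket_pow_mul_le hN0 h₁ h₂
  have hc : 0 ≤ bracket (-2 * ξ) ^ (n + 1) * N :=
    mul_nonneg (pow_nonneg (bracket_pos _).le _) hN0
  have k₂ := bracket_pow_mul_le (x := -2 * ξ) (N := |2 * x| ^ (m + 1) * N) (k := n + 1)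
    (by positivity) h₃ (by linarith)
  have k₃ := bracket_pow_mul_le (x := 2 * x) (k := m + 1) hc k₁ (by linarith)
  calc _ = ‖a * (-2) ^ n * 2 ^ m‖ * (bracket x ^ (m + 1) * (bracket ξ ^ (n + 1) * N)) := by ring
    _ ≤ ‖a * (-2) ^ n * 2 ^ m‖ *
        (bracket (2 * x) ^ (m + 1) * (bracket (-2 * ξ) ^ (n + 1) * N)) := by
      gcongr
      exact pow_nonneg (bracket_pos _).le _
    _ ≤ _ := by gcongr

section Cutoff

variable {ζ : ℝ → ℝ}

lemma contDiff_cutoff_div (hζ : ContDiff ℝ (⊤ : ℕ∞) ζ) (h0 : ∀ x, |x| < 1 → ζ x = 0) :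
    ContDiff ℝ (⊤ : ℕ∞) fun x : ℝ => ((ζ x / x : ℝ) : ℂ) := by
  refine Complex.ofRealCLM.contDiff.comp (contDiff_iff_contDiffAt.2 fun x => ?_)
  by_cases hx : x = 0
  · refine (contDiffAt_const (c := (0 : ℝ))).congr_of_eventuallyEq ?_
    have : ∀ᶠ y : ℝ in nhds x, |y| < 1 :=
      (isOpen_lt continuous_abs continuous_const).mem_nhds (by simp [hx])
    filter_upwards [this] with y hy
    change ζ y / y = 0
    rw [h0 y hy, zero_div]
  · exact hζ.contDiffAt.div contDiffAt_id hx

lemma iteratedDeriv_cutoff_div (h1 : ∀ x, 2 ≤ |x| → ζ x = 1) (m : ℕ) :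
    ∀ x : ℝ, 2 < |x| → iteratedDeriv m (fun x : ℝ => ((ζ x / x : ℝ) : ℂ)) x =
      (-1) ^ m * m.factorial / (x : ℂ) ^ (m + 1) := by
  induction m with
  | zero =>
    intro x hx
    simp [h1 x hx.le]
  | succ m ih =>
    intro x hx
    have hx0 : (x : ℂ) ≠ 0 := by
      rw [Complex.ofReal_ne_zero]
      rintro rfl
      norm_num at hx
    have he : iteratedDeriv m (fun x : ℝ => ((ζ x / x : ℝ) : ℂ)) =ᶠ[nhds x]
        fun x : ℝ => (-1) ^ m * m.factorial / (x : ℂ) ^ (m + 1) := by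
      filter_upwards [(isOpen_lt continuous_const continuous_abs).mem_nhds hx] with y hy
        using ih y hy
    rw [iteratedDeriv_succ, he.deriv_eq]
    have hd : HasDerivAt (fun x : ℝ => (x : ℂ)) 1 x := (hasDerivAt_id x).ofReal_comp
    refine ((hasDerivAt_const x ((-1 : ℂ) ^ m * m.factorial)).div (hd.pow (m + 1))
      (pow_ne_zero _ hx0)).deriv.trans ?_
    rw [Nat.factorial_succ]
    simp only [Nat.add_sub_cancel, Pi.pow_apply]
    push_cast
    field_simp
    ring

lemma exists_bound_cutoff_div (hζ : ContDiff ℝ (⊤ : ℕ∞) ζ) (h1 : ∀ x, 2 ≤ |x| → ζ x = 1)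
    (h0 : ∀ x, |x| < 1 → ζ x = 0) (m : ℕ) :
    ∃ C : ℝ, ∀ x : ℝ,
      bracket x ^ (m + 1) * ‖iteratedDeriv m (fun x : ℝ => ((ζ x / x : ℝ) : ℂ)) x‖ ≤ C := by
  have hc : Continuous (iteratedDeriv m (fun x : ℝ => ((ζ x / x : ℝ) : ℂ))) :=
    (contDiff_cutoff_div hζ h0).continuous_iteratedDeriv m (by exact_mod_cast le_top)
  have hb : Continuous bracket := by
    unfold bracket
    fun_prop
  obtain ⟨C, hC⟩ := (isCompact_Icc (a := (-2 : ℝ)) (b := 2)).bddAbove_image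
    ((hb.pow (m + 1)).mul hc.norm).continuousOn
  refine ⟨max C (2 ^ (m + 1) * m.factorial), fun x => ?_⟩
  rcases le_or_gt |x| 2 with hx | hx
  · exact le_max_of_le_left (hC ⟨x, abs_le.1 hx, rfl⟩)
  · refine le_max_of_le_right ?_
    rw [iteratedDeriv_cutoff_div h1 m x hx]
    have hp : 0 < |x| := by linarith
    have hw := bracket_le_two_mul (r := |x|) (by linarith) le_rfl
    have hb0 := (bracket_pos x).le
    calc _ ≤ (2 * |x|) ^ (m + 1) * (m.factorial / |x| ^ (m + 1)) := by
          simp only [norm_div, norm_mul, norm_pow, norm_neg, norm_one, one_pow, one_mul,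
            Complex.norm_natCast, Complex.norm_real, Real.norm_eq_abs]
          gcongr
      _ = _ := by
          rw [mul_pow]
          field_simp

lemma pdxi_sub_cutoff {φ : ℝ × ℝ → ℂ} (hφ : IsTestFun φ) (a A : ℂ) {k : ℝ → ℂ}
    (hk : ContDiff ℝ (⊤ : ℕ∞) k) (m n : ℕ) (x ξ : ℝ) :
    pdxi m n (fun p => a * quarterInt (-2 * p.2) (2 * p.1) φ - A * k p.1 * k p.2) x ξ =
      pdxi m n (fun p => a * quarterInt (-2 * p.2) (2 * p.1) φ) x ξ -
        A * iteratedDeriv m k x * iteratedDeriv n k ξ := by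
  have hn : ∀ j : ℕ, ((j : ℕ∞) : WithTop ℕ∞) ≤ ((⊤ : ℕ∞) : WithTop ℕ∞) :=
    fun j => by exact_mod_cast le_top
  have s₁ : ∀ x' : ℝ, ContDiff ℝ (⊤ : ℕ∞) fun y : ℝ => a * quarterInt (-2 * y) (2 * x') φ :=
    fun x' => contDiff_const.mul ((contDiff_quarterInt hφ).comp
      ((contDiff_const.mul contDiff_id).prodMk contDiff_const))
  have s₂ : ContDiff ℝ (⊤ : ℕ∞) fun y : ℝ => a * ((-2 : ℝ) : ℂ) ^ n *
      quarterInt (-2 * ξ) (2 * y) fun p => (Complex.I * p.1) ^ n * φ p :=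
    contDiff_const.mul ((contDiff_quarterInt (hφ.I_mul_fst_pow_mul n)).comp
      (contDiff_const.prodMk (contDiff_const.mul contDiff_id)))
  simp only [pdxi]
  have hin : ∀ x' : ℝ, iteratedDeriv n
      (fun y : ℝ => a * quarterInt (-2 * y) (2 * x') φ - A * k x' * k y) ξ =
      a * ((-2 : ℝ) : ℂ) ^ n *
        quarterInt (-2 * ξ) (2 * x') (fun p => (Complex.I * p.1) ^ n * φ p) -
        A * iteratedDeriv n k ξ * k x' := by
    intro x'
    rw [iteratedDeriv_fun_sub ((s₁ x').of_le (hn n)).contDiffAt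
      ((contDiff_const.mul hk).of_le (hn n)).contDiffAt, iteratedDeriv_quarterInt_fst hφ,
      iteratedDeriv_const_mul_field (A * k x')]
    ring
  simp only [hin, iteratedDeriv_quarterInt_fst hφ]
  rw [iteratedDeriv_fun_sub (s₂.of_le (hn m)).contDiffAt
    ((contDiff_const.mul hk).of_le (hn m)).contDiffAt,
    iteratedDeriv_const_mul_field (A * iteratedDeriv n k ξ)]
  ring

lemma exists_bound_bracket_pdxi_sub_cutoff {φ : ℝ × ℝ → ℂ} (hφ : IsTestFun φ) (a : ℂ)
    (hζ : ContDiff ℝ (⊤ : ℕ∞) ζ) (h1 : ∀ x, 2 ≤ |x| → ζ x = 1)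
    (h0 : ∀ x, |x| < 1 → ζ x = 0) (m n : ℕ) :
    ∃ C : ℝ, ∀ x ξ : ℝ, bracket x ^ (m + 2) * bracket ξ ^ (n + 2) *
      ‖pdxi m n (fun p => a * quarterInt (-2 * p.2) (2 * p.1) φ -
        a / 4 * φ (0, 0) * ((ζ p.1 / p.1 : ℝ) : ℂ) * ((ζ p.2 / p.2 : ℝ) : ℂ)) x ξ‖ ≤
      C * (bracket x + bracket ξ) := by
  obtain ⟨C₁, hC₁⟩ := exists_bound_bracket_pdxi_quarterInt hφ a m n
  obtain ⟨C₂, hC₂⟩ := exists_bound_cutoff_div hζ h1 h0 m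
  obtain ⟨C₃, hC₃⟩ := exists_bound_cutoff_div hζ h1 h0 n
  obtain ⟨C₄, hC₄⟩ := exists_bound_quarterInt_moment_remainder hφ m n
  have p₁ : 0 ≤ C₁ := le_trans (by have := (bracket_pos 0).le; positivity) (hC₁ 0 0)
  have p₂ : 0 ≤ C₂ := le_trans (by have := (bracket_pos 0).le; positivity) (hC₂ 0)
  have p₃ : 0 ≤ C₃ := le_trans (by have := (bracket_pos 0).le; positivity) (hC₃ 0)
  have p₄ : 0 ≤ C₄ := by
    have := (mul_nonneg (by positivity) (norm_nonneg _)).trans (hC₄ 1 1)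
    norm_num at this
    linarith
  set k : ℝ → ℂ := fun x => ((ζ x / x : ℝ) : ℂ) with hk
  set C₀ := C₁ + ‖a / 4 * φ (0, 0)‖ * C₂ * C₃ with hC₀
  have p₀ : 0 ≤ C₀ := by positivity
  set C₅ := 2 ^ (m + n + 4) * (‖a / 16‖ * C₄ * 2)
  have p₅ : 0 ≤ C₅ := by positivity
  refine ⟨4 * C₀ + C₅, fun x ξ => ?_⟩
  rw [pdxi_sub_cutoff hφ a (a / 4 * φ (0, 0)) (contDiff_cutoff_div hζ h0)]
  set P := pdxi m n (fun p => a * quarterInt (-2 * p.2) (2 * p.1) φ) x ξ -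
    a / 4 * φ (0, 0) * iteratedDeriv m k x * iteratedDeriv n k ξ with hP
  have bx := bracket_pos x
  have bξ := bracket_pos ξ
  have hsmall : bracket x ^ (m + 1) * bracket ξ ^ (n + 1) * ‖P‖ ≤ C₀ := by
    calc _ ≤ bracket x ^ (m + 1) * bracket ξ ^ (n + 1) *
          (‖pdxi m n (fun p => a * quarterInt (-2 * p.2) (2 * p.1) φ) x ξ‖ +
            ‖a / 4 * φ (0, 0) * iteratedDeriv m k x * iteratedDeriv n k ξ‖) := by
          gcongr
          exact norm_sub_le _ _
      _ = bracket x ^ (m + 1) * (bracket ξ ^ (n + 1) *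
            ‖pdxi m n (fun p => a * quarterInt (-2 * p.2) (2 * p.1) φ) x ξ‖) +
          ‖a / 4 * φ (0, 0)‖ * (bracket x ^ (m + 1) * ‖iteratedDeriv m k x‖) *
            (bracket ξ ^ (n + 1) * ‖iteratedDeriv n k ξ‖) := by
          rw [norm_mul (_ * _) (iteratedDeriv n k ξ), norm_mul _ (iteratedDeriv m k x)]
          ring
      _ ≤ _ := by
          have t₁ := hC₁ x ξ
          have t₂ := hC₂ x
          have t₃ := hC₃ ξ
          rw [hC₀]
          gcongr
  rcases le_or_gt |x| 2 with hx | hx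
  · have hw : bracket x ≤ 4 := (bracket_le_two_mul (r := 2) (by norm_num) hx).trans (by norm_num)
    calc _ = bracket x * bracket ξ * (bracket x ^ (m + 1) * bracket ξ ^ (n + 1) * ‖P‖) := by ring
      _ ≤ 4 * bracket ξ * C₀ := by gcongr
      _ ≤ _ := by nlinarith [mul_nonneg p₀ bx.le, mul_nonneg p₅ bx.le, mul_nonneg p₅ bξ.le]
  rcases le_or_gt |ξ| 2 with hξ | hξ
  · have hw : bracket ξ ≤ 4 := (bracket_le_two_mul (r := 2) (by norm_num) hξ).trans (by norm_num)
    calc _ = bracket x * bracket ξ * (bracket x ^ (m + 1) * bracket ξ ^ (n + 1) * ‖P‖) := by ring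
      _ ≤ bracket x * 4 * C₀ := by gcongr
      _ ≤ _ := by nlinarith [mul_nonneg p₀ bξ.le, mul_nonneg p₅ bx.le, mul_nonneg p₅ bξ.le]
  have hx0 : (x : ℂ) ≠ 0 := by
    rw [Complex.ofReal_ne_zero]
    rintro rfl
    norm_num at hx
  have hξ0 : (ξ : ℂ) ≠ 0 := by
    rw [Complex.ofReal_ne_zero]
    rintro rfl
    norm_num at hξ
  have hmain : (x : ℂ) ^ (m + 1) * (ξ : ℂ) ^ (n + 1) * P = -(a / 4) *
      (((-2 * ξ : ℝ) : ℂ) ^ (n + 1) * ((2 * x : ℝ) : ℂ) ^ (m + 1) *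
        quarterInt (-2 * ξ) (2 * x)
          (fun p => (Complex.I * p.1) ^ n * ((Complex.I * p.2) ^ m * φ p)) +
        (-1) ^ m * m.factorial * ((-1) ^ n * n.factorial) * φ (0, 0)) := by
    rw [hP, pdxi_quarterInt hφ, iteratedDeriv_cutoff_div h1 m x hx,
      iteratedDeriv_cutoff_div h1 n ξ hξ]
    push_cast
    rw [mul_pow _ (ξ : ℂ), mul_pow _ (x : ℂ)]
    field_simp
    ring
  have hr := hC₄ (-2 * ξ) (2 * x)
  have hnorm : |x| ^ (m + 1) * |ξ| ^ (n + 1) * ‖P‖ = ‖a / 4‖ *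
      ‖((-2 * ξ : ℝ) : ℂ) ^ (n + 1) * ((2 * x : ℝ) : ℂ) ^ (m + 1) *
        quarterInt (-2 * ξ) (2 * x)
          (fun p => (Complex.I * p.1) ^ n * ((Complex.I * p.2) ^ m * φ p)) +
        (-1) ^ m * m.factorial * ((-1) ^ n * n.factorial) * φ (0, 0)‖ := by
    rw [← norm_neg (a / 4), ← norm_mul, ← hmain]
    simp only [norm_mul, norm_pow, Complex.norm_real, Real.norm_eq_abs]
  have e₁ : |-2 * ξ| = 2 * |ξ| := by rw [abs_mul]; norm_num
  have e₂ : |2 * x| = 2 * |x| := by rw [abs_mul]; norm_num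
  rw [e₁, e₂] at hr
  set R := ‖((-2 * ξ : ℝ) : ℂ) ^ (n + 1) * ((2 * x : ℝ) : ℂ) ^ (m + 1) *
    quarterInt (-2 * ξ) (2 * x)
      (fun p => (Complex.I * p.1) ^ n * ((Complex.I * p.2) ^ m * φ p)) +
    (-1) ^ m * m.factorial * ((-1) ^ n * n.factorial) * φ (0, 0)‖
  have e₃ : ‖a / 4‖ = 4 * ‖a / 16‖ := by
    simp only [norm_div]
    norm_num
    ring
  calc bracket x ^ (m + 2) * bracket ξ ^ (n + 2) * ‖P‖
      ≤ (2 * |x|) ^ (m + 2) * (2 * |ξ|) ^ (n + 2) * ‖P‖ := by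
        gcongr
        · exact bracket_le_two_mul (by linarith) le_rfl
        · exact bracket_le_two_mul (by linarith) le_rfl
    _ = 2 ^ (m + n + 4) * (|x| * |ξ| * (|x| ^ (m + 1) * |ξ| ^ (n + 1) * ‖P‖)) := by ring
    _ = 2 ^ (m + n + 4) * (‖a / 16‖ * (2 * |ξ| * (2 * |x|) * R)) := by
        rw [hnorm, e₃]
        ring
    _ ≤ 2 ^ (m + n + 4) * (‖a / 16‖ * (C₄ * (2 * |ξ| + 2 * |x|))) := by gcongr
    _ = C₅ * (|x| + |ξ|) := by ring
    _ ≤ C₅ * (bracket x + bracket ξ) := by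
        gcongr
        · exact abs_le_bracket x
        · exact abs_le_bracket ξ
    _ ≤ _ := by
        gcongr
        linarith

end Cutoff

lemma sector_pi_div_two : sector (Real.pi / 2) = Set.Ioi (0 : ℝ) ×ˢ Set.Ioi (0 : ℝ) := by
  ext ⟨x, y⟩
  simp only [sector, Set.mem_ofPred_eq, Set.mem_prod, Set.mem_Ioi, arg2pi]
  set z : ℂ := (x : ℂ) + y * Complex.I with hz
  have hre : z.re = x := by simp [hz]
  have him : z.im = y := by simp [hz]
  split_ifs with h
  · have h' := Complex.arg_nonneg_iff.1 h
    rw [h.lt_iff_ne', Ne, Complex.arg_eq_zero_iff, Complex.arg_lt_pi_div_two_iff, Complex.ext_iff,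
      hre, him]
    rw [him] at h'
    simp only [Complex.zero_re, Complex.zero_im]
    grind
  · have h' := Complex.neg_pi_lt_arg z
    rw [not_le, Complex.arg_neg_iff, him] at h
    have := Real.pi_pos
    constructor
    · rintro ⟨-, h2⟩
      linarith
    · rintro ⟨-, h2⟩
      linarith

lemma dualSymb1_quarter {φ : ℝ × ℝ → ℂ} (hφ : IsTestFun φ) :
    dualSymb1 (Set.indicator (sector (Real.pi / 2)) φ) =
      fun p => (Real.pi : ℂ)⁻¹ * quarterInt (-2 * p.2) (2 * p.1) φ := by
  ext p
  have hi := hφ.integrand_integrable (-2 * p.2) (2 * p.1)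
  have hm : MeasurableSet (Set.Ioi (0 : ℝ) ×ˢ Set.Ioi (0 : ℝ)) :=
    measurableSet_Ioi.prod measurableSet_Ioi
  rw [dualSymb1, Ftrans1, quarterInt, ← integral_indicator hm, Measure.volume_eq_prod,
    integral_prod _ (hi.indicator hm), sector_pi_div_two]
  have e : ∀ x ξ : ℝ, Complex.exp (-Complex.I * ((-(2 * p.1) * ξ + 2 * p.2 * x : ℝ) : ℂ)) *
      (Set.Ioi (0 : ℝ) ×ˢ Set.Ioi (0 : ℝ)).indicator φ (x, ξ) =
      (Set.Ioi (0 : ℝ) ×ˢ Set.Ioi (0 : ℝ)).indicator (fun q : ℝ × ℝ =>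
        Complex.exp (Complex.I * ((-2 * p.2 * q.1 + 2 * p.1 * q.2 : ℝ) : ℂ)) * φ q) (x, ξ) := by
    intro x ξ
    by_cases h : (x, ξ) ∈ Set.Ioi (0 : ℝ) ×ˢ Set.Ioi (0 : ℝ)
    · rw [Set.indicator_of_mem h, Set.indicator_of_mem h]
      congr 2
      push_cast
      ring
    · rw [Set.indicator_of_notMem h, Set.indicator_of_notMem h, mul_zero]
  simp only [e]
  push_cast
  have := Real.pi_ne_zero
  field_simp

/-- **Theorem.** Let `Ω = Ω_{π/2}` and `φ ∈ C_0^∞(ℝ²)`. The dual symbol `φ*_Ω` of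
`φ_Ω = 1_Ω φ` is smooth, satisfies `|∂_x^m ∂_ξ^n φ*_Ω| ≲ ⟨x⟩^{-1-m} ⟨ξ⟩^{-1-n}`, and for any
cut-off `ζ` one has `φ*_Ω = b₀ + b₁` with
`b₀(x,ξ) = (4π)^{-1} φ(0,0) (ζ(x)/x)(ζ(ξ)/ξ)` and
`|∂_x^m ∂_ξ^n b₁| ≲ ⟨x⟩^{-1-m}⟨ξ⟩^{-2-n} + ⟨x⟩^{-2-m}⟨ξ⟩^{-1-n}`. -/
theorem dual_symbol_quarter_plane
    (φ : ℝ × ℝ → ℝ) (hφ_smooth : ContDiff ℝ (⊤ : ℕ∞) φ) (hφ_supp : HasCompactSupport φ)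
    (b : ℝ × ℝ → ℂ)
    (hb : b = dualSymb1 (Set.indicator (sector (Real.pi / 2)) fun τ => (φ τ : ℂ))) :
    ContDiff ℝ (⊤ : ℕ∞) b ∧
    (∀ m n : ℕ, ∃ C : ℝ, ∀ x ξ : ℝ,
      ‖pdxi m n b x ξ‖ ≤ C * jbr (1 + m) x * jbr (1 + n) ξ) ∧
    (∀ ζ : ℝ → ℝ, ContDiff ℝ (⊤ : ℕ∞) ζ → (∀ x, 2 ≤ |x| → ζ x = 1) → (∀ x, |x| < 1 → ζ x = 0) →
      ∃ b₁ : ℝ × ℝ → ℂ,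
        (∀ x ξ : ℝ, b (x, ξ) =
          (((4 * Real.pi)⁻¹ * φ (0, 0) * (ζ x / x) * (ζ ξ / ξ) : ℝ) : ℂ) + b₁ (x, ξ)) ∧
        ∀ m n : ℕ, ∃ C : ℝ, ∀ x ξ : ℝ,
          ‖pdxi m n b₁ x ξ‖ ≤
            C * (jbr (1 + m) x * jbr (2 + n) ξ + jbr (2 + m) x * jbr (1 + n) ξ)) := by
  have hf : IsTestFun fun τ => (φ τ : ℂ) :=
    ⟨Complex.ofRealCLM.contDiff.comp hφ_smooth, hφ_supp.comp_left Complex.ofReal_zero⟩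
  rw [dualSymb1_quarter hf] at hb
  subst hb
  refine ⟨?_, fun m n => ?_, fun ζ hζ h1 h0 => ?_⟩
  · exact contDiff_const.mul ((contDiff_quarterInt hf).comp
      ((contDiff_const.mul contDiff_snd).prodMk (contDiff_const.mul contDiff_fst)))
  · obtain ⟨C, hC⟩ := exists_bound_bracket_pdxi_quarterInt hf (Real.pi : ℂ)⁻¹ m n
    refine ⟨C, fun x ξ => ?_⟩
    have hx := pow_pos (bracket_pos x) (m + 1)
    have hξ := pow_pos (bracket_pos ξ) (n + 1)
    rw [jbr_one_add, jbr_one_add, ← div_eq_mul_inv, ← div_eq_mul_inv, le_div_iff₀ hξ,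
      le_div_iff₀ hx]
    refine (le_of_eq ?_).trans (hC x ξ)
    ring
  · refine ⟨fun p => (Real.pi : ℂ)⁻¹ *
      quarterInt (-2 * p.2) (2 * p.1) (fun τ => (φ τ : ℂ)) -
        (Real.pi : ℂ)⁻¹ / 4 * φ (0, 0) * ((ζ p.1 / p.1 : ℝ) : ℂ) * ((ζ p.2 / p.2 : ℝ) : ℂ),
      fun x ξ => ?_, fun m n => ?_⟩
    · push_cast
      rw [mul_inv]
      ring
    · obtain ⟨C, hC⟩ := exists_bound_bracket_pdxi_sub_cutoff hf (Real.pi : ℂ)⁻¹ hζ h1 h0 m n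
      refine ⟨C, fun x ξ => ?_⟩
      have bx := bracket_pos x
      have bξ := bracket_pos ξ
      have e : C * (jbr (1 + m) x * jbr (2 + n) ξ + jbr (2 + m) x * jbr (1 + n) ξ) =
          C * (bracket x + bracket ξ) / (bracket x ^ (m + 2) * bracket ξ ^ (n + 2)) := by
        simp only [jbr_one_add, jbr_two_add]
        field_simp
        ring
      rw [e, le_div_iff₀ (by positivity), mul_comm]
      exact hC x ξ

end
end

section
/- Let Ω ⊂ ℝ^{2d}, d ≥ 1, be a bounded open convex set with C^∞ boundary of strictly positive curvature, and let A_Ω = Op^w(1_Ω). Then A_Ω ∈ S_{p,∞} with p = 4d/(2d+1), i.e. the singular values satisfy s_k(A_Ω) ≲ k^{−1/2 − 1/(4d)} for k = 1,2,…. -/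
open MeasureTheory Filter Complex
open scoped ENNReal InnerProductSpace RealInnerProductSpace

noncomputable section

abbrev Ed (d : ℕ) := EuclideanSpace ℝ (Fin d)
abbrev L2 (d : ℕ) := MeasureTheory.Lp ℂ 2 (volume : Measure (Ed d))

/-- approximation numbers = singular values -/
def sVal {H : Type*} [NormedAddCommGroup H] [NormedSpace ℂ H]
    (A : H →L[ℂ] H) (k : ℕ) : ℝ :=
  sInf ((fun F : H →L[ℂ] H => ‖A - F‖) ''
    {F | Module.rank ℂ (LinearMap.range (F : H →ₗ[ℂ] H)) ≤ (k : Cardinal)})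

/-- the `t`-quantization integral formula -/
def opIntegral (d : ℕ) (t : ℝ) (a : Ed d × Ed d → ℂ) (u : Ed d → ℂ) (x : Ed d) : ℂ :=
  (((2 * Real.pi) ^ (-(d : ℝ)) : ℝ) : ℂ) *
    ∫ ξ : Ed d, ∫ y : Ed d,
      Complex.exp (Complex.I * (⟪x - y, ξ⟫_ℝ : ℂ)) * a ((1 - t) • x + t • y, ξ) * u y

def IsOpT (d : ℕ) (t : ℝ) (a : Ed d × Ed d → ℂ) (T : L2 d →L[ℂ] L2 d) : Prop :=
  ∀ u : SchwartzMap (Ed d) ℂ, ∀ f : L2 d, (⇑f =ᵐ[volume] ⇑u) →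
    ⇑(T f) =ᵐ[volume] opIntegral d t a ⇑u

/-- On `L¹ ∩ L²`, the Fourier transform of `L²` is given by the Fourier integral. -/
theorem fourier_toLp_ae_eq {d : ℕ} {f : Ed d → ℂ} (h₁ : Integrable f) (h₂ : MemLp f 2) :
    ⇑(FourierTransform.fourier (h₂.toLp f) : Lp ℂ 2 (volume : Measure (Ed d)))
      =ᵐ[volume] (FourierTransform.fourier f : Ed d → ℂ) := by
  have hloc : LocallyIntegrable (⇑(FourierTransform.fourier (h₂.toLp f) :
      Lp ℂ 2 (volume : Measure (Ed d)))) volume :=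
    (Lp.memLp _).locallyIntegrable (by norm_num)
  have hcont : Continuous (FourierTransform.fourier f : Ed d → ℂ) :=
    VectorFourier.fourierIntegral_continuous Real.continuous_fourierChar
      (by exact continuous_inner) h₁
  refine ae_eq_of_integral_contDiff_smul_eq hloc hcont.locallyIntegrable fun φ hφ hφc => ?_
  have hφ' : ContDiff ℝ (⊤ : ℕ∞) (fun x => (φ x : ℂ)) := ofRealCLM.contDiff.comp hφ
  have hφc' : HasCompactSupport (fun x => (φ x : ℂ)) := hφc.comp_left (g := ofReal) rfl
  set ψ : SchwartzMap (Ed d) ℂ := hφc'.toSchwartzMap hφ' with hψ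
  have hψa : ∀ x, ψ x = (φ x : ℂ) := fun x => rfl
  have key := congrArg (fun F => F ψ) (Lp.fourier_toTemperedDistribution_eq (h₂.toLp f))
  simp only [TemperedDistribution.fourier_apply, Lp.toTemperedDistribution_apply] at key
  calc ∫ x, φ x • (FourierTransform.fourier (h₂.toLp f) : Lp ℂ 2 (volume : Measure (Ed d))) x
      = ∫ x, ψ x • (FourierTransform.fourier (h₂.toLp f) : Lp ℂ 2 (volume : Measure (Ed d))) x := by
        simp [hψa]
    _ = ∫ x, (FourierTransform.fourier ψ) x • (h₂.toLp f) x := key.symm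
    _ = ∫ x, (FourierTransform.fourier (ψ : Ed d → ℂ)) x • f x := by
        refine integral_congr_ae ?_
        filter_upwards [h₂.coeFn_toLp] with x hx
        rw [hx, SchwartzMap.fourier_coe]
    _ = ∫ x, ψ x • (FourierTransform.fourier f : Ed d → ℂ) x :=
        VectorFourier.integral_fourierIntegral_smul_eq_flip (L := innerₗ (Ed d))
          Real.continuous_fourierChar (by exact continuous_inner) ψ.integrable h₁ |>.trans (by
            simp [FourierTransform.fourier, flip_innerₗ])
    _ = ∫ x, φ x • (FourierTransform.fourier f : Ed d → ℂ) x := by simp [hψa]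

/-- Plancherel's theorem, for the Fourier integral with kernel `exp (i ⟪t, ξ⟫)`. -/
theorem lintegral_enorm_fourierIntegral_sq {d : ℕ} {f : Ed d → ℂ} (h₁ : Integrable f)
    (h₂ : MemLp f 2) :
    ∫⁻ t : Ed d, ‖∫ ξ : Ed d, Complex.exp (Complex.I * (⟪t, ξ⟫_ℝ : ℂ)) * f ξ‖ₑ ^ 2 =
      ENNReal.ofReal ((2 * Real.pi) ^ d) * ∫⁻ ξ : Ed d, ‖f ξ‖ₑ ^ 2 := by
  have hL2 : ∀ g : Ed d → ℂ, ∫⁻ ξ, ‖g ξ‖ₑ ^ 2 = eLpNorm g 2 volume ^ 2 := fun g => by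
    rw [eLpNorm_eq_lintegral_rpow_enorm_toReal (by norm_num) (by norm_num), ← ENNReal.rpow_natCast,
      ← ENNReal.rpow_mul]
    simp
  have hP : ∫⁻ w, ‖(FourierTransform.fourier f : Ed d → ℂ) w‖ₑ ^ 2 = ∫⁻ ξ, ‖f ξ‖ₑ ^ 2 := by
    rw [hL2, hL2, ← eLpNorm_congr_ae (fourier_toLp_ae_eq h₁ h₂), ← eLpNorm_congr_ae h₂.coeFn_toLp,
      ← Lp.enorm_def, ← Lp.enorm_def, ← ofReal_norm, ← ofReal_norm, Lp.norm_fourier_eq]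
  set G : Ed d → ℂ := fun t => ∫ ξ : Ed d, Complex.exp (Complex.I * (⟪t, ξ⟫_ℝ : ℂ)) * f ξ with hG
  have hGF : ∀ w, (FourierTransform.fourier f : Ed d → ℂ) w = G ((-2 * Real.pi) • w) := fun w => by
    rw [Real.fourier_eq', hG]
    refine integral_congr_ae (Eventually.of_forall fun ξ => ?_)
    simp only [inner_smul_left, smul_eq_mul]
    rw [real_inner_comm]
    congr 2
    simp only [map_mul, conj_trivial, mul_comm]
  have hne : (-2 * Real.pi) ≠ 0 := by simp [Real.pi_ne_zero]
  have hmap := lintegral_map_equiv (μ := (volume : Measure (Ed d))) (fun t => ‖G t‖ₑ ^ 2)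
    (Homeomorph.smulOfNeZero (-2 * Real.pi) hne).toMeasurableEquiv
  have hm2 := Measure.map_addHaar_smul (volume : Measure (Ed d)) hne
  rw [show (⇑(Homeomorph.smulOfNeZero (-2 * Real.pi) hne).toMeasurableEquiv : Ed d → Ed d) =
    fun x => (-2 * Real.pi) • x from rfl] at hmap
  rw [hm2, lintegral_smul_measure] at hmap
  rw [← hP]
  simp only [hGF]
  rw [← hmap, smul_eq_mul, ← mul_assoc, ← ENNReal.ofReal_mul (by positivity)]
  simp only [finrank_euclideanSpace, Fintype.card_fin]
  have : (2 * Real.pi) ^ d * |((-2 * Real.pi) ^ d)⁻¹| = 1 := by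
    rw [abs_inv, abs_pow, abs_mul, abs_neg, abs_two, abs_of_pos Real.pi_pos,
      mul_inv_cancel₀ (by positivity)]
  rw [this, ENNReal.ofReal_one, one_mul]

section SingularValues

variable {H : Type*} [NormedAddCommGroup H]

theorem sVal_le_norm_sub [NormedSpace ℂ H] (A F : H →L[ℂ] H) {k : ℕ}
    (hF : Module.rank ℂ (LinearMap.range (F : H →ₗ[ℂ] H)) ≤ (k : Cardinal)) :
    sVal A k ≤ ‖A - F‖ :=
  csInf_le ⟨0, by rintro _ ⟨G, -, rfl⟩; exact norm_nonneg _⟩ ⟨F, hF, rfl⟩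

theorem rank_range_zero_le [NormedSpace ℂ H] (k : ℕ) :
    Module.rank ℂ (LinearMap.range ((0 : H →L[ℂ] H) : H →ₗ[ℂ] H)) ≤ (k : Cardinal) := by
  simp

theorem sVal_antitone [NormedSpace ℂ H] (A : H →L[ℂ] H) : Antitone (sVal A) := fun m n hmn =>
  csInf_le_csInf ⟨0, by rintro _ ⟨G, -, rfl⟩; exact norm_nonneg _⟩
    ⟨_, 0, rank_range_zero_le m, rfl⟩
    (Set.image_mono fun _ hF => le_trans (Set.mem_ofPred_eq ▸ hF) (by exact_mod_cast hmn))

variable [InnerProductSpace ℂ H]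

theorem rank_range_comp_starProjection_le (B : H →L[ℂ] H) (V : Submodule ℂ H)
    [V.HasOrthogonalProjection] :
    Module.rank ℂ (LinearMap.range ((B ∘L V.starProjection : H →L[ℂ] H) : H →ₗ[ℂ] H)) ≤
      Module.rank ℂ V := by
  have : LinearMap.range ((B ∘L V.starProjection : H →L[ℂ] H) : H →ₗ[ℂ] H) ≤
      V.map (B : H →ₗ[ℂ] H) := by
    rintro _ ⟨u, rfl⟩
    exact ⟨V.starProjection u, V.starProjection_apply_mem u, rfl⟩
  have h2 := lift_rank_map_le (B : H →ₗ[ℂ] H) V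
  simp only [Cardinal.lift_id] at h2
  exact (Submodule.rank_mono this).trans h2

/-- If no operator of rank at most `k` is within distance `c` of `B`, then `B` expands `k + 1`
orthonormal vectors by more than `c`. -/
theorem exists_orthonormal_of_lt_norm_sub (B : H →L[ℂ] H) {k : ℕ} {c : ℝ} (hc : 0 ≤ c)
    (h : ∀ F : H →L[ℂ] H, Module.rank ℂ (LinearMap.range (F : H →ₗ[ℂ] H)) ≤ (k : Cardinal) →
      c < ‖B - F‖) (n : ℕ) (hn : n ≤ k + 1) :
    ∃ v : Fin n → H, Orthonormal ℂ v ∧ ∀ j, c < ‖B (v j)‖ := by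
  induction n with
  | zero => exact ⟨Fin.elim0, ⟨fun i => i.elim0, fun i => i.elim0⟩, fun i => i.elim0⟩
  | succ n ih =>
    obtain ⟨v, hv, hvc⟩ := ih (by omega)
    set S : Submodule ℂ H := Submodule.span ℂ (Set.range v) with hS
    have hSr : Module.rank ℂ S ≤ (k : Cardinal) := by
      refine (rank_span_le _).trans ?_
      have := Cardinal.mk_range_le_lift (f := v)
      simp only [Cardinal.lift_uzero, Cardinal.mk_fin, Cardinal.lift_natCast] at this
      exact this.trans (by exact_mod_cast (by omega : n ≤ k))
    have : FiniteDimensional ℂ S := FiniteDimensional.span_of_finite ℂ (Set.finite_range v)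
    have hlt := h (B ∘L S.starProjection) ((rank_range_comp_starProjection_le B S).trans hSr)
    obtain ⟨u, hu⟩ : ∃ u, c * ‖u‖ < ‖(B - B ∘L S.starProjection) u‖ := by
      by_contra! hcon
      exact absurd (ContinuousLinearMap.opNorm_le_bound _ hc hcon) (not_le.mpr hlt)
    set w := u - S.starProjection u with hw
    have hBw : (B - B ∘L S.starProjection) u = B w := by simp [hw]
    have hwS : w ∈ Sᗮ := S.sub_starProjection_mem_orthogonal u
    have hwu : ‖w‖ ≤ ‖u‖ := by
      have : w = Sᗮ.starProjection u := by
        rw [Submodule.starProjection_orthogonal]; simp [hw]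
      rw [this]
      exact Submodule.norm_starProjection_apply_le _ _
    have hBw' : c * ‖w‖ < ‖B w‖ := by
      rw [← hBw]; exact (mul_le_mul_of_nonneg_left hwu hc).trans_lt hu
    have hw0 : 0 < ‖w‖ := by
      rw [norm_pos_iff]; rintro h0; rw [h0] at hBw'; simp at hBw'
    set e : H := ((‖w‖⁻¹ : ℝ) : ℂ) • w with he
    have hen : ‖e‖ = 1 := by
      rw [he, norm_smul]; simp [hw0.ne']
    have hev : ∀ j, ⟪v j, e⟫_ℂ = 0 := fun j => by
      rw [he, inner_smul_right, hwS (v j) (Submodule.subset_span ⟨j, rfl⟩), mul_zero]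
    refine ⟨Fin.cons e v, ⟨?_, ?_⟩, ?_⟩
    · intro i
      refine Fin.cases ?_ (fun i => ?_) i
      · simpa using hen
      · simpa using hv.1 i
    · intro i j
      refine Fin.cases ?_ (fun i => ?_) i <;> refine Fin.cases ?_ (fun j => ?_) j
      · simp
      · intro _
        simpa [inner_eq_zero_symm] using hev j
      · intro _
        simpa using hev i
      · intro hij
        simpa using hv.2 (fun h => hij (by rw [h]))
    · intro j
      refine Fin.cases ?_ (fun j => ?_) j
      · simp only [Fin.cons_zero, he, map_smul, norm_smul]
        rw [norm_real, norm_inv, norm_norm, inv_mul_eq_div, lt_div_iff₀ hw0]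
        exact hBw'
      · simpa using hvc j

/-- A Hilbert–Schmidt bound off a subspace of dimension at most `N` controls `sVal A (N + k)`. -/
theorem sVal_add_le_of_sum_sq_le (A : H →L[ℂ] H) (V : Submodule ℂ H)
    [V.HasOrthogonalProjection] {N k : ℕ} (hV : Module.rank ℂ V ≤ (N : Cardinal)) {β : ℝ}
    (hβ : ∀ v : Fin (k + 1) → H, Orthonormal ℂ v →
      ∑ j, ‖A (v j - V.starProjection (v j))‖ ^ 2 ≤ β) :
    sVal A (N + k) ≤ √(β / (k + 1)) := by
  by_contra! hcon
  set B := A - A ∘L V.starProjection with hB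
  have h : ∀ F : H →L[ℂ] H, Module.rank ℂ (LinearMap.range (F : H →ₗ[ℂ] H)) ≤ (k : Cardinal) →
      √(β / (k + 1)) < ‖B - F‖ := fun F hF => by
    refine hcon.trans_le ?_
    rw [hB, sub_sub]
    apply sVal_le_norm_sub
    rw [ContinuousLinearMap.toLinearMap_add]
    refine (LinearMap.rank_add_le _ _).trans ?_
    push_cast
    exact add_le_add ((rank_range_comp_starProjection_le A V).trans hV) hF
  obtain ⟨v, hv, hvc⟩ := exists_orthonormal_of_lt_norm_sub B (Real.sqrt_nonneg _) h (k + 1) le_rfl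
  have h1 := hβ v hv
  have h2 : ∑ _j : Fin (k + 1), β / (k + 1) < ∑ j, ‖A (v j - V.starProjection (v j))‖ ^ 2 := by
    refine Finset.sum_lt_sum_of_nonempty Finset.univ_nonempty fun j _ => ?_
    have := hvc j
    rw [Real.sqrt_lt' ((Real.sqrt_nonneg _).trans_lt this)] at this
    simpa [hB] using this
  simp only [Finset.sum_const, Finset.card_univ, Fintype.card_fin, nsmul_eq_mul] at h2
  push_cast at h2
  rw [mul_div_cancel₀ _ (by positivity)] at h2
  linarith

end SingularValues

section PiecewiseConstant

variable {d : ℕ}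

/-- The index of the cell of the grid of mesh `1 / n` which contains a point. -/
def gridIndex (n : ℕ) (y : Ed d) : Fin d → ℤ := fun j => ⌊(n : ℝ) * y j⌋

/-- The lower corner of a cell of the grid of mesh `1 / n`. -/
def gridCorner (n : ℕ) (κ : Fin d → ℤ) : Ed d := WithLp.toLp 2 fun j => (κ j : ℝ) / n

/-- The cells of the grid of mesh `1 / n` which cover `[-n, n)^d`. -/
def gridCells (d n : ℕ) : Finset (Fin d → ℤ) :=
  Fintype.piFinset fun _ => Finset.Ico (-(n : ℤ) ^ 2) ((n : ℤ) ^ 2)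

/-- The half-open cube `[0, 1 / n)^d`. -/
def unitCell (d n : ℕ) : Set (Ed d) := {h | ∀ j, 0 ≤ h j ∧ h j < 1 / n}

/-- The open cube `(-1 / n, 1 / n)^d`. -/
def openCube (d n : ℕ) : Set (Ed d) := {h | ∀ j, |h j| < 1 / n}

theorem card_gridCells (d n : ℕ) : (gridCells d n).card = (2 * n ^ 2) ^ d := by
  simp only [gridCells, Fintype.card_piFinset, Int.card_Ico, Finset.prod_const, Finset.card_univ,
    Fintype.card_fin]
  congr 1
  have : ((n : ℤ) ^ 2 - -(n : ℤ) ^ 2) = ((2 * n ^ 2 : ℕ) : ℤ) := by push_cast; ring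
  rw [this, Int.toNat_natCast]

@[fun_prop]
theorem measurable_gridIndex (n : ℕ) : Measurable (gridIndex (d := d) n) :=
  measurable_pi_lambda _ fun j => by
    refine Int.measurable_floor.comp ?_
    fun_prop

theorem measurable_gridCorner (n : ℕ) : Measurable (gridCorner (d := d) n) :=
  Measurable.of_discrete

theorem norm_le_of_forall_abs_le {y : Ed d} {B : ℝ} (h : ∀ j, |y j| ≤ B) : ‖y‖ ≤ d * B := by
  rcases Nat.eq_zero_or_pos d with rfl | hd
  · simp [EuclideanSpace.norm_eq]
  have hB : 0 ≤ B := (abs_nonneg _).trans (h ⟨0, hd⟩)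
  have hd1 : (1 : ℝ) ≤ d := by exact_mod_cast hd
  rw [EuclideanSpace.norm_eq]
  refine Real.sqrt_le_iff.mpr ⟨by positivity, ?_⟩
  calc ∑ i, ‖y i‖ ^ 2 ≤ ∑ _i : Fin d, B ^ 2 :=
        Finset.sum_le_sum fun i _ => by
          rw [Real.norm_eq_abs]; exact pow_le_pow_left₀ (abs_nonneg _) (h i) 2
    _ = d * B ^ 2 := by simp
    _ ≤ (d * B) ^ 2 := by
        rw [mul_pow]; exact mul_le_mul_of_nonneg_right (by nlinarith) (by positivity)

theorem measurableSet_gridCell (n : ℕ) (κ : Fin d → ℤ) :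
    MeasurableSet {y : Ed d | gridIndex n y = κ} :=
  measurable_gridIndex n (measurableSet_singleton κ)

theorem volume_gridCell_ne_top {n : ℕ} (hn : 0 < n) (κ : Fin d → ℤ) :
    volume {y : Ed d | gridIndex n y = κ} ≠ ∞ := by
  have hn' : (0 : ℝ) < n := by exact_mod_cast hn
  have hb : Bornology.IsBounded {y : Ed d | gridIndex n y = κ} := by
    rw [isBounded_iff_forall_norm_le]
    refine ⟨d * (∑ j, (|(κ j : ℝ)| + 1)), fun y hy => norm_le_of_forall_abs_le fun j => ?_⟩
    have h1 : |(κ j : ℝ)| + 1 ≤ ∑ j, (|(κ j : ℝ)| + 1) :=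
      Finset.single_le_sum (f := fun j => |(κ j : ℝ)| + 1) (fun i _ => by positivity)
        (Finset.mem_univ j)
    have h2 : ⌊(n : ℝ) * y j⌋ = κ j := congrFun hy j
    rw [Int.floor_eq_iff] at h2
    have h3 : |(n : ℝ) * y j| ≤ |(κ j : ℝ)| + 1 := by
      rw [abs_le]
      constructor <;> cases abs_cases (κ j : ℝ) <;> linarith
    have h4 : |y j| ≤ |(n : ℝ) * y j| := by
      rw [abs_mul, abs_of_pos hn']
      exact le_mul_of_one_le_left (abs_nonneg _) (Nat.one_le_cast.mpr hn)
    linarith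
  exact hb.measure_lt_top.ne

theorem volume_unitCell (d n : ℕ) : volume (unitCell d n) = ENNReal.ofReal (1 / n) ^ d := by
  have : unitCell d n = (WithLp.ofLp : Ed d → Fin d → ℝ) ⁻¹'
      (Set.pi Set.univ fun _ => Set.Ico 0 (1 / (n : ℝ))) := by
    ext h; simp [unitCell]
  rw [this, (PiLp.volume_preserving_ofLp (Fin d)).measure_preimage
    (MeasurableSet.univ_pi fun _ => measurableSet_Ico).nullMeasurableSet, Real.volume_pi_Ico]
  simp

theorem volume_openCube (d n : ℕ) :
    volume (openCube d n) = 2 ^ d * ENNReal.ofReal (1 / n) ^ d := by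
  have : openCube d n = (WithLp.ofLp : Ed d → Fin d → ℝ) ⁻¹'
      (Set.pi Set.univ fun _ => Set.Ioo (-(1 / (n : ℝ))) (1 / (n : ℝ))) := by
    ext h; simp [openCube, abs_lt]
  rw [this, (PiLp.volume_preserving_ofLp (Fin d)).measure_preimage
    (MeasurableSet.univ_pi fun _ => measurableSet_Ioo).nullMeasurableSet, Real.volume_pi_Ioo]
  simp only [sub_neg_eq_add, ← two_mul]
  rw [Finset.prod_const, ENNReal.ofReal_mul (by norm_num), mul_pow]
  simp

theorem measurableSet_unitCell (d n : ℕ) : MeasurableSet (unitCell d n) := by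
  simp only [unitCell, Set.ofPred_forall, Set.ofPred_and]
  refine MeasurableSet.iInter fun j => MeasurableSet.inter ?_ ?_
  · exact measurableSet_le measurable_const (by fun_prop)
  · exact measurableSet_lt (by fun_prop) measurable_const

theorem measurableSet_openCube (d n : ℕ) : MeasurableSet (openCube d n) := by
  simp only [openCube, Set.ofPred_forall]
  refine MeasurableSet.iInter fun j => measurableSet_lt ?_ measurable_const
  exact Measurable.abs (by fun_prop)

theorem gridCorner_add_sub_mem_openCube {n : ℕ} (hn : 0 < n) (y : Ed d) {h : Ed d}
    (hh : h ∈ unitCell d n) : gridCorner n (gridIndex n y) - y + h ∈ openCube d n := by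
  intro j
  have hn' : (0 : ℝ) < n := by exact_mod_cast hn
  obtain ⟨h1, h2⟩ := hh j
  have h3 := Int.floor_le ((n : ℝ) * y j)
  have h4 := Int.lt_floor_add_one ((n : ℝ) * y j)
  have h5 : (⌊(n : ℝ) * y j⌋ : ℝ) / n ≤ y j := by rw [div_le_iff₀ hn']; linarith
  have h6 : y j < (⌊(n : ℝ) * y j⌋ : ℝ) / n + 1 / n := by
    rw [← add_div, lt_div_iff₀ hn']; linarith
  simp only [gridCorner, gridIndex, PiLp.add_apply, PiLp.sub_apply]
  rw [abs_lt]
  constructor <;> linarith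

/-- The span in `L²` of the indicator functions of the cells covering `[-n, n)^d`. -/
def gridSpace (d : ℕ) {n : ℕ} (hn : 0 < n) : Submodule ℂ (L2 d) :=
  Submodule.span ℂ (Set.range fun κ : gridCells d n =>
    indicatorConstLp 2 (measurableSet_gridCell n κ.1) (volume_gridCell_ne_top hn κ.1) (1 : ℂ))

instance (d : ℕ) {n : ℕ} (hn : 0 < n) : FiniteDimensional ℂ (gridSpace d hn) :=
  FiniteDimensional.span_of_finite ℂ (Set.finite_range _)

theorem rank_gridSpace_le (d : ℕ) {n : ℕ} (hn : 0 < n) :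
    Module.rank ℂ (gridSpace d hn) ≤ (((2 * n ^ 2) ^ d : ℕ) : Cardinal) := by
  refine (rank_span_le _).trans (Cardinal.mk_range_le.trans ?_)
  rw [Cardinal.mk_fintype, Fintype.card_coe, card_gridCells]

theorem enorm_sq_eq_lintegral (f : L2 d) : ‖f‖ₑ ^ 2 = ∫⁻ y, ‖f y‖ₑ ^ 2 := by
  rw [Lp.enorm_def, eLpNorm_eq_lintegral_rpow_enorm_toReal (by norm_num) (by norm_num),
    ← ENNReal.rpow_natCast, ← ENNReal.rpow_mul]
  simp

theorem enorm_sub_starProjection_sq_le {f : Ed d → ℂ} {F : L2 d} (hF : ⇑F =ᵐ[volume] f)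
    {n : ℕ} (hn : 0 < n) (h : Ed d) :
    ‖F - (gridSpace d hn).starProjection F‖ₑ ^ 2 ≤
      ∫⁻ y, ‖f y - {y | gridIndex n y ∈ gridCells d n}.indicator
        (fun y => f (gridCorner n (gridIndex n y) + h)) y‖ₑ ^ 2 := by
  set b : (Fin d → ℤ) → L2 d := fun κ =>
    indicatorConstLp 2 (measurableSet_gridCell n κ) (volume_gridCell_ne_top hn κ) (1 : ℂ) with hb
  set v : L2 d := ∑ κ ∈ gridCells d n, f (gridCorner n κ + h) • b κ with hv
  have hvV : v ∈ gridSpace d hn := Submodule.sum_mem _ fun κ hκ =>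
    Submodule.smul_mem _ _ (Submodule.subset_span ⟨⟨κ, hκ⟩, rfl⟩)
  have hle : ‖F - (gridSpace d hn).starProjection F‖ ≤ ‖F - v‖ := by
    rw [Submodule.starProjection_minimal]
    exact ciInf_le ⟨0, by rintro _ ⟨w, rfl⟩; exact norm_nonneg _⟩
      (⟨v, hvV⟩ : gridSpace d hn)
  have hle' : ‖F - (gridSpace d hn).starProjection F‖ₑ ≤ ‖F - v‖ₑ := by
    rw [← ofReal_norm, ← ofReal_norm]; exact ENNReal.ofReal_le_ofReal hle
  refine (pow_le_pow_left' hle' 2).trans ?_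
  rw [enorm_sq_eq_lintegral]
  refine le_of_eq (lintegral_congr_ae ?_)
  have hvae : ⇑v =ᵐ[volume] {y | gridIndex n y ∈ gridCells d n}.indicator
        (fun y => f (gridCorner n (gridIndex n y) + h)) := by
    have h1 : ∀ s : Finset (Fin d → ℤ),
        ⇑(∑ κ ∈ s, f (gridCorner n κ + h) • b κ : L2 d) =ᵐ[volume]
          fun y => ∑ κ ∈ s, f (gridCorner n κ + h) *
            ({y | gridIndex n y = κ}.indicator (fun _ => (1 : ℂ)) y) := by
      intro s
      induction s using Finset.induction_on with
      | empty =>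
        filter_upwards [Lp.coeFn_zero ℂ 2 (volume : Measure (Ed d))] with y hy
        simp only [Finset.sum_empty]
        exact hy
      | insert κ s hκ ih =>
        rw [Finset.sum_insert hκ]
        filter_upwards [Lp.coeFn_add (f (gridCorner n κ + h) • b κ)
          (∑ κ ∈ s, f (gridCorner n κ + h) • b κ), ih,
          Lp.coeFn_smul (f (gridCorner n κ + h)) (b κ),
          indicatorConstLp_coeFn (p := 2) (hs := measurableSet_gridCell n κ)
            (hμs := volume_gridCell_ne_top hn κ) (c := (1 : ℂ))] with y h1 h2 h3 h4
        rw [h1, Pi.add_apply, h2, h3, Pi.smul_apply, hb, h4, Finset.sum_insert hκ, smul_eq_mul]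
    filter_upwards [h1 (gridCells d n)] with y hy
    rw [hv, hy]
    by_cases hm : gridIndex n y ∈ gridCells d n
    · rw [Set.indicator_of_mem (by exact hm), Finset.sum_eq_single_of_mem _ hm]
      · simp
      · intro κ _ hκ
        rw [Set.indicator_of_notMem (fun h => hκ (by exact h.symm)), mul_zero]
    · rw [Set.indicator_of_notMem (by exact hm)]
      refine Finset.sum_eq_zero fun κ hκ => ?_
      rw [Set.indicator_of_notMem, mul_zero]
      rintro rfl
      exact hm hκ
  filter_upwards [Lp.coeFn_sub F v, hF, hvae] with y h1 h2 h3
  rw [h1, Pi.sub_apply, h2, h3]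

/-- The distance in `L²` to the functions which are constant on the cells of a grid is controlled
by the modulus of continuity in `L²` and the mass away from the grid. -/
theorem volume_mul_enorm_sub_starProjection_sq_le {f : Ed d → ℂ} {F : L2 d} (hF : ⇑F =ᵐ[volume] f)
    (hfm : Measurable f) {n : ℕ} (hn : 0 < n) :
    volume (unitCell d n) *
        ‖F - (gridSpace d hn).starProjection F‖ₑ ^ 2 ≤
      (∫⁻ y, ∫⁻ η in openCube d n, ‖f y - f (y + η)‖ₑ ^ 2) +
        volume (unitCell d n) * ∫⁻ y in {y | gridIndex n y ∉ gridCells d n}, ‖f y‖ₑ ^ 2 := by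
  have hms : MeasurableSet {y : Ed d | gridIndex n y ∈ gridCells d n} :=
    measurable_gridIndex n (Set.to_countable (gridCells d n : Set (Fin d → ℤ))).measurableSet
  have hmF : Measurable fun p : Ed d × Ed d =>
      ‖f p.2 - {y | gridIndex n y ∈ gridCells d n}.indicator
        (fun y => f (gridCorner n (gridIndex n y) + p.1)) p.2‖ₑ ^ 2 := by
    have h1 : Measurable fun p : Ed d × Ed d =>
        {p : Ed d × Ed d | gridIndex n p.2 ∈ gridCells d n}.indicator
          (fun p => f (gridCorner n (gridIndex n p.2) + p.1)) p := by
      refine Measurable.indicator (hfm.comp ?_) (measurable_snd hms)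
      exact ((measurable_gridCorner n).comp
        ((measurable_gridIndex n).comp measurable_snd)).add measurable_fst
    exact (((hfm.comp measurable_snd).sub h1).enorm).pow_const 2
  calc volume (unitCell d n) *
        ‖F - (gridSpace d hn).starProjection F‖ₑ ^ 2
      = ∫⁻ _h in unitCell d n,
          ‖F - (gridSpace d hn).starProjection F‖ₑ ^ 2 := by
        rw [setLIntegral_const, mul_comm]
    _ ≤ ∫⁻ h in unitCell d n, ∫⁻ y, ‖f y - {y | gridIndex n y ∈ gridCells d n}.indicator
        (fun y => f (gridCorner n (gridIndex n y) + h)) y‖ₑ ^ 2 :=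
        lintegral_mono fun h => enorm_sub_starProjection_sq_le hF hn h
    _ = ∫⁻ y, ∫⁻ h in unitCell d n, ‖f y - {y | gridIndex n y ∈ gridCells d n}.indicator
        (fun y => f (gridCorner n (gridIndex n y) + h)) y‖ₑ ^ 2 :=
        lintegral_lintegral_swap hmF.aemeasurable
    _ ≤ ∫⁻ y, ((∫⁻ η in openCube d n, ‖f y - f (y + η)‖ₑ ^ 2) +
          {y | gridIndex n y ∉ gridCells d n}.indicator
            (fun y => volume (unitCell d n) * ‖f y‖ₑ ^ 2) y) := by
        refine lintegral_mono fun y => ?_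
        by_cases hy : gridIndex n y ∈ gridCells d n
        · refine le_add_right ?_
          simp only [Set.indicator_of_mem (s := {y | gridIndex n y ∈ gridCells d n}) hy]
          rw [← lintegral_indicator (measurableSet_unitCell d n),
            ← lintegral_indicator (measurableSet_openCube d n)]
          rw [← lintegral_add_left_eq_self (fun η => (openCube d n).indicator
            (fun η => ‖f y - f (y + η)‖ₑ ^ 2) η) (gridCorner n (gridIndex n y) - y)]
          refine lintegral_mono fun h => ?_
          by_cases hh : h ∈ unitCell d n
          · rw [Set.indicator_of_mem hh,
              Set.indicator_of_mem (gridCorner_add_sub_mem_openCube hn y hh)]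
            apply le_of_eq
            congr 4
            abel
          · rw [Set.indicator_of_notMem hh]; exact zero_le
        · refine le_add_left ?_
          rw [Set.indicator_of_mem (by exact hy)]
          simp only [Set.indicator_of_notMem (s := {y | gridIndex n y ∈ gridCells d n}) hy,
            sub_zero, setLIntegral_const]
          rw [mul_comm]
    _ = _ := by
        have hm2 : Measurable fun y => ∫⁻ η in openCube d n, ‖f y - f (y + η)‖ₑ ^ 2 := by
          refine Measurable.lintegral_prod_right' (f := fun p : Ed d × Ed d =>
            ‖f p.1 - f (p.1 + p.2)‖ₑ ^ 2) ?_
          exact (((hfm.comp measurable_fst).sub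
            (hfm.comp (measurable_fst.add measurable_snd))).enorm).pow_const 2
        rw [lintegral_add_left hm2, lintegral_indicator (by exact hms.compl),
          lintegral_const_mul _ (hfm.enorm.pow_const 2)]

end PiecewiseConstant

section WeylKernel

variable {d : ℕ} {Ω : Set (Ed d × Ed d)} {M : ℝ}

/-- The Fourier integral in the momentum variable of the indicator function of `Ω`. -/
def sliceFourier (Ω : Set (Ed d × Ed d)) (m t : Ed d) : ℂ :=
  ∫ ξ : Ed d, Complex.exp (Complex.I * (⟪t, ξ⟫_ℝ : ℂ)) * Ω.indicator (fun _ => (1 : ℂ)) (m, ξ)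

/-- The integral kernel of the Weyl quantization of the indicator function of `Ω`. -/
def weylKernel (Ω : Set (Ed d × Ed d)) (x y : Ed d) : ℂ :=
  (((2 * Real.pi) ^ (-(d : ℝ)) : ℝ) : ℂ) *
    sliceFourier Ω ((1 - 1 / 2 : ℝ) • x + (1 / 2 : ℝ) • y) (x - y)

theorem measurable_sliceFourier (hΩ : MeasurableSet Ω) :
    Measurable fun p : Ed d × Ed d => sliceFourier Ω p.1 p.2 := by
  have h : Measurable fun q : (Ed d × Ed d) × Ed d =>
      Complex.exp (Complex.I * (⟪q.1.2, q.2⟫_ℝ : ℂ)) *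
        Ω.indicator (fun _ => (1 : ℂ)) (q.1.1, q.2) := by
    refine Measurable.mul (Continuous.measurable (by fun_prop)) ?_
    exact (measurable_const.indicator hΩ).comp (by fun_prop)
  exact (StronglyMeasurable.integral_prod_right' (ν := volume) h.stronglyMeasurable).measurable

theorem measurable_weylKernel (hΩ : MeasurableSet Ω) :
    Measurable fun p : Ed d × Ed d => weylKernel Ω p.1 p.2 := by
  refine Measurable.const_mul ?_ _
  exact (measurable_sliceFourier hΩ).comp
    (f := fun p : Ed d × Ed d => ((1 - 1 / 2 : ℝ) • p.1 + (1 / 2 : ℝ) • p.2, p.1 - p.2))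
    (by fun_prop)

theorem norm_indicator_le (hM : ∀ τ ∈ Ω, ‖τ‖ ≤ M) (m ξ : Ed d) :
    ‖Ω.indicator (fun _ => (1 : ℂ)) (m, ξ)‖ ≤
      (Metric.closedBall (0 : Ed d) M).indicator (fun _ => (1 : ℝ)) ξ := by
  by_cases h : (m, ξ) ∈ Ω
  · have : ξ ∈ Metric.closedBall (0 : Ed d) M := by
      rw [mem_closedBall_zero_iff]; exact (norm_snd_le (m, ξ)).trans (hM _ h)
    rw [Set.indicator_of_mem h, Set.indicator_of_mem this, norm_one]
  · rw [Set.indicator_of_notMem h, norm_zero]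
    exact Set.indicator_nonneg (fun _ _ => zero_le_one) _

theorem integrable_indicator_closedBall (d : ℕ) (M : ℝ) :
    Integrable ((Metric.closedBall (0 : Ed d) M).indicator fun _ => (1 : ℝ)) :=
  (integrable_indicator_iff Metric.isClosed_closedBall.measurableSet).mpr
    (integrableOn_const (hs := measure_closedBall_lt_top.ne))

theorem norm_sliceFourier_le (hM : ∀ τ ∈ Ω, ‖τ‖ ≤ M) (m t : Ed d) :
    ‖sliceFourier Ω m t‖ ≤
      ∫ ξ, (Metric.closedBall (0 : Ed d) M).indicator (fun _ => (1 : ℝ)) ξ := by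
  refine norm_integral_le_of_norm_le (integrable_indicator_closedBall d M)
    (Eventually.of_forall fun ξ => ?_)
  rw [norm_mul, norm_exp_I_mul_ofReal, one_mul]
  exact norm_indicator_le hM m ξ

theorem sliceFourier_eq_zero (hM : ∀ τ ∈ Ω, ‖τ‖ ≤ M) {m : Ed d} (hm : M < ‖m‖) (t : Ed d) :
    sliceFourier Ω m t = 0 := by
  rw [sliceFourier, ← integral_zero (Ed d) ℂ]
  congr 1
  ext ξ
  rw [Set.indicator_of_notMem, mul_zero]
  exact fun h => absurd ((norm_fst_le (m, ξ)).trans (hM _ h)) (not_le.mpr hm)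

theorem memLp_weylKernel (hΩ : MeasurableSet Ω) (hM : ∀ τ ∈ Ω, ‖τ‖ ≤ M) (x : Ed d) :
    MemLp (weylKernel Ω x) 2 := by
  have hmeas : Measurable (weylKernel Ω x) :=
    Measurable.of_uncurry_left (f := weylKernel Ω) (measurable_weylKernel hΩ)
  have hind : (Metric.closedBall (0 : Ed d) (2 * M + ‖x‖)).indicator (weylKernel Ω x) =
      weylKernel Ω x := by
    rw [Set.indicator_eq_self]
    intro y hy
    rw [mem_closedBall_zero_iff]
    by_contra! hlt
    refine hy ?_
    rw [weylKernel, sliceFourier_eq_zero hM, mul_zero]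
    have h1 : (1 / 2 : ℝ) * ‖y‖ ≤
        ‖(1 - 1 / 2 : ℝ) • x + (1 / 2 : ℝ) • y‖ + (1 / 2 : ℝ) * ‖x‖ := by
      have := norm_sub_le ((1 - 1 / 2 : ℝ) • x + (1 / 2 : ℝ) • y) ((1 - 1 / 2 : ℝ) • x)
      rw [add_sub_cancel_left, norm_smul, norm_smul] at this
      norm_num at this ⊢
      exact this
    linarith
  rw [← hind, memLp_indicator_iff_restrict Metric.isClosed_closedBall.measurableSet]
  have : IsFiniteMeasure (volume.restrict (Metric.closedBall (0 : Ed d) (2 * M + ‖x‖))) :=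
    ⟨by simpa using measure_closedBall_lt_top⟩
  refine MemLp.of_bound hmeas.aestronglyMeasurable
    ((2 * Real.pi) ^ (-(d : ℝ)) *
      ∫ ξ, (Metric.closedBall (0 : Ed d) M).indicator (fun _ => (1 : ℝ)) ξ)
    (Eventually.of_forall fun y => ?_)
  rw [weylKernel, norm_mul, norm_real, Real.norm_of_nonneg (by positivity)]
  gcongr
  exact norm_sliceFourier_le hM _ _

theorem opIntegral_indicator_eq (hΩ : MeasurableSet Ω) (hM : ∀ τ ∈ Ω, ‖τ‖ ≤ M) {u : Ed d → ℂ}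
    (hu : Integrable u) (x : Ed d) :
    opIntegral d (1 / 2) (Ω.indicator fun _ => (1 : ℂ)) u x = ∫ y, weylKernel Ω x y * u y := by
  rw [opIntegral, integral_integral_swap]
  · rw [← integral_const_mul]
    congr 1
    ext y
    rw [weylKernel, sliceFourier, mul_assoc, ← integral_mul_const]
  · refine Integrable.mono' ((integrable_indicator_closedBall d M).mul_prod hu.norm) ?_
      (Eventually.of_forall fun p => ?_)
    · refine AEStronglyMeasurable.mul (Measurable.aestronglyMeasurable ?_)
        hu.aestronglyMeasurable.comp_snd
      refine Measurable.mul (Continuous.measurable (by fun_prop)) ?_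
      exact (measurable_const.indicator hΩ).comp (by fun_prop)
    · simp only [Function.uncurry, norm_mul, norm_exp_I_mul_ofReal, one_mul]
      gcongr
      exact norm_indicator_le hM _ _

/-- The conjugate of a row of the Weyl kernel, as an element of `L²`. -/
def weylRow (hΩ : MeasurableSet Ω) (hM : ∀ τ ∈ Ω, ‖τ‖ ≤ M) (x : Ed d) : L2 d :=
  (memLp_weylKernel hΩ hM x).star.toLp

theorem coeFn_weylRow (hΩ : MeasurableSet Ω) (hM : ∀ τ ∈ Ω, ‖τ‖ ≤ M) (x : Ed d) :
    ⇑(weylRow hΩ hM x) =ᵐ[volume] fun y => star (weylKernel Ω x y) :=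
  MemLp.coeFn_toLp _

theorem inner_weylRow (hΩ : MeasurableSet Ω) (hM : ∀ τ ∈ Ω, ‖τ‖ ≤ M) (x : Ed d) {f : L2 d}
    {u : Ed d → ℂ} (hu : ⇑f =ᵐ[volume] u) :
    ⟪weylRow hΩ hM x, f⟫_ℂ = ∫ y, weylKernel Ω x y * u y := by
  rw [L2.inner_def]
  refine integral_congr_ae ?_
  filter_upwards [coeFn_weylRow hΩ hM x, hu] with y h1 h2
  rw [h1, h2]
  simp [mul_comm]

theorem apply_ae_eq_inner_weylRow (hΩ : MeasurableSet Ω) (hM : ∀ τ ∈ Ω, ‖τ‖ ≤ M)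
    {T : L2 d →L[ℂ] L2 d} (hT : IsOpT d (1 / 2) (Ω.indicator fun _ => (1 : ℂ)) T) (f : L2 d) :
    ⇑(T f) =ᵐ[volume] fun x => ⟪weylRow hΩ hM x, f⟫_ℂ := by
  have hS : ∀ u : SchwartzMap (Ed d) ℂ,
      ⇑(T (u.toLp 2)) =ᵐ[volume] fun x => ⟪weylRow hΩ hM x, u.toLp 2⟫_ℂ := fun u => by
    filter_upwards [hT u (u.toLp 2) (u.coeFn_toLp 2)] with x hx
    rw [hx, opIntegral_indicator_eq hΩ hM u.integrable,
      inner_weylRow hΩ hM x (u.coeFn_toLp 2 volume)]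
  have hd : f ∈ closure (Set.range (SchwartzMap.toLpCLM ℂ ℂ 2 (volume : Measure (Ed d)))) :=
    SchwartzMap.denseRange_toLpCLM (by norm_num) f
  obtain ⟨w, hw, hwf⟩ := mem_closure_iff_seq_limit.mp hd
  have hTw : Tendsto (fun n => T (w n)) atTop (nhds (T f)) := (T.continuous.tendsto f).comp hwf
  obtain ⟨ns, hns, hae⟩ := (tendstoInMeasure_of_tendsto_Lp hTw).exists_seq_tendsto_ae
  have hall : ∀ n, ⇑(T (w n)) =ᵐ[volume] fun x => ⟪weylRow hΩ hM x, w n⟫_ℂ := fun n => by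
    obtain ⟨u, hu⟩ := hw n
    rw [← hu]
    exact hS u
  filter_upwards [hae, ae_all_iff.mpr hall] with x h1 h2
  refine tendsto_nhds_unique h1 ?_
  simp only [h2]
  exact ((continuous_const.inner continuous_id).tendsto f).comp
    (hwf.comp hns.tendsto_atTop)

/-- The Hilbert–Schmidt norm of the operator off a subspace is computed on the rows of its
kernel. -/
theorem sum_norm_sq_le_lintegral_weylRow (hΩ : MeasurableSet Ω) (hM : ∀ τ ∈ Ω, ‖τ‖ ≤ M)
    {T : L2 d →L[ℂ] L2 d} (hT : IsOpT d (1 / 2) (Ω.indicator fun _ => (1 : ℂ)) T)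
    (V : Submodule ℂ (L2 d)) [V.HasOrthogonalProjection] {k : ℕ} {v : Fin k → L2 d}
    (hv : Orthonormal ℂ v) :
    ENNReal.ofReal (∑ j, ‖T (v j - V.starProjection (v j))‖ ^ 2) ≤
      ∫⁻ x, ‖weylRow hΩ hM x - V.starProjection (weylRow hΩ hM x)‖ₑ ^ 2 := by
  rw [ENNReal.ofReal_sum_of_nonneg fun _ _ => by positivity]
  have h1 : ∀ f : L2 d, ENNReal.ofReal (‖f‖ ^ 2) = ∫⁻ y, ‖f y‖ₑ ^ 2 := fun f => by
    rw [ENNReal.ofReal_pow (norm_nonneg _), ofReal_norm, enorm_sq_eq_lintegral]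
  simp only [h1]
  rw [← lintegral_finsetSum' _ fun j _ => ((Lp.aestronglyMeasurable _).enorm.pow_const 2)]
  refine lintegral_mono_ae ?_
  filter_upwards [ae_all_iff.mpr fun j =>
    apply_ae_eq_inner_weylRow hΩ hM hT (v j - V.starProjection (v j))] with x hx
  simp only [hx]
  set r := weylRow hΩ hM x
  have h2 : ∀ j, ⟪r, v j - V.starProjection (v j)⟫_ℂ = ⟪r - V.starProjection r, v j⟫_ℂ :=
    fun j => by
      rw [inner_sub_right, inner_sub_left, ← Submodule.inner_starProjection_left_eq_right]
  have h3 : ∑ j, ‖⟪v j, r - V.starProjection r⟫_ℂ‖ ^ 2 ≤ ‖r - V.starProjection r‖ ^ 2 :=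
    hv.sum_inner_products_le _
  calc ∑ j, ‖⟪r, v j - V.starProjection (v j)⟫_ℂ‖ₑ ^ 2
      = ENNReal.ofReal (∑ j, ‖⟪v j, r - V.starProjection r⟫_ℂ‖ ^ 2) := by
        rw [ENNReal.ofReal_sum_of_nonneg fun _ _ => by positivity]
        refine Finset.sum_congr rfl fun j _ => ?_
        rw [h2, ENNReal.ofReal_pow (norm_nonneg _), ← ofReal_norm, norm_inner_symm]
    _ ≤ ENNReal.ofReal (‖r - V.starProjection r‖ ^ 2) := ENNReal.ofReal_le_ofReal h3
    _ = _ := by rw [ENNReal.ofReal_pow (norm_nonneg _), ofReal_norm]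

end WeylKernel

section Convex

theorem one_add_pow_le (n : ℕ) {ε : ℝ} (h0 : 0 ≤ ε) (h1 : ε ≤ 1) :
    (1 + ε) ^ n ≤ 1 + (2 ^ n - 1) * ε := by
  induction n with
  | zero => simp
  | succ n ih =>
    have h2 : (1 : ℝ) ≤ 2 ^ n := one_le_pow₀ (by norm_num)
    calc (1 + ε) ^ (n + 1) ≤ (1 + (2 ^ n - 1) * ε) * (1 + ε) := by
          rw [pow_succ]; gcongr
      _ ≤ _ := by
          rw [pow_succ]
          nlinarith [mul_nonneg (mul_nonneg (sub_nonneg.2 h2) h0) (sub_nonneg.2 h1)]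

variable {E : Type*} [NormedAddCommGroup E] [NormedSpace ℝ E] [FiniteDimensional ℝ E]
  [MeasurableSpace E] [BorelSpace E] {μ : Measure E} [μ.IsAddHaarMeasure]

theorem volume_translate_diff_le {Ω : Set E} (hopen : IsOpen Ω) (hbdd : Bornology.IsBounded Ω)
    (hconv : Convex ℝ Ω) {z : E} {r : ℝ} (hr : 0 < r) (hz : Metric.closedBall z r ⊆ Ω) (h : E) :
    μ {τ | τ + h ∈ Ω ∧ τ ∉ Ω} ≤
      ENNReal.ofReal (2 ^ Module.finrank ℝ E * (‖h‖ / r)) * μ Ω := by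
  set ε := ‖h‖ / r with hε
  have hε0 : 0 ≤ ε := by positivity
  have hn1 : (1 : ℝ) ≤ 2 ^ Module.finrank ℝ E := one_le_pow₀ (by norm_num)
  have hzΩ : z ∈ Ω := hz (Metric.mem_closedBall_self hr.le)
  rcases le_or_gt ε 1 with hε1 | hε1
  · set D : Set E := AffineMap.homothety z (1 + ε) '' Ω with hD
    have hpos : 0 < 1 + ε := by positivity
    have hmemD : ∀ τ, z + (1 + ε)⁻¹ • (τ - z) ∈ Ω → τ ∈ D := fun τ hτ => by
      refine ⟨_, hτ, ?_⟩
      rw [AffineMap.homothety_apply]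
      simp [smul_smul, mul_inv_cancel₀ hpos.ne']
    have hΩD : Ω ⊆ D := fun τ hτ => hmemD τ <| by
      have := hconv hzΩ hτ (a := ε / (1 + ε)) (b := (1 + ε)⁻¹) (by positivity) (by positivity)
        (by field_simp; ring)
      convert this using 1
      have h2 : ε / (1 + ε) = 1 - (1 + ε)⁻¹ := by field_simp; ring
      rw [h2]
      module
    have hsub : {τ | τ + h ∈ Ω ∧ τ ∉ Ω} ⊆ D \ Ω := by
      rintro τ ⟨h1, h2⟩
      refine ⟨hmemD τ ?_, h2⟩
      have hne : h ≠ 0 := by rintro rfl; exact h2 (by simpa using h1)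
      have hεpos : 0 < ε := div_pos (norm_pos_iff.mpr hne) hr
      have hw : z - ε⁻¹ • h ∈ Ω := hz <| by
        rw [Metric.mem_closedBall, dist_eq_norm, sub_sub_cancel_left, norm_neg, norm_smul, norm_inv,
          Real.norm_of_nonneg hε0, hε]
        field_simp
        exact le_refl _
      have := hconv hw h1 (a := ε / (1 + ε)) (b := (1 + ε)⁻¹) (by positivity) (by positivity)
        (by field_simp; ring)
      convert this using 1
      have h3 : (ε / (1 + ε)) • (z - ε⁻¹ • h) = (1 - (1 + ε)⁻¹) • z - (1 + ε)⁻¹ • h := by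
        rw [smul_sub, smul_smul]
        congr 2 <;> field_simp
        ring
      rw [h3]
      module
    calc μ {τ | τ + h ∈ Ω ∧ τ ∉ Ω} ≤ μ (D \ Ω) := measure_mono hsub
      _ = μ D - μ Ω :=
          measure_sdiff hΩD hopen.measurableSet.nullMeasurableSet hbdd.measure_lt_top.ne
      _ ≤ _ := by
          rw [tsub_le_iff_right, hD, Measure.addHaar_image_homothety, abs_of_pos (by positivity)]
          nth_rw 3 [← one_mul (μ Ω)]
          rw [← add_mul, ← ENNReal.ofReal_one, ← ENNReal.ofReal_add (by positivity) zero_le_one]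
          gcongr
          have := one_add_pow_le (Module.finrank ℝ E) hε0 hε1
          nlinarith
  · calc μ {τ | τ + h ∈ Ω ∧ τ ∉ Ω} ≤ μ ((fun τ => τ + h) ⁻¹' Ω) := measure_mono fun τ hτ => hτ.1
      _ = μ Ω := measure_preimage_add_right μ h Ω
      _ = ENNReal.ofReal 1 * μ Ω := by simp
      _ ≤ _ := by
          gcongr
          nlinarith

/-- The modulus of continuity in `L²` of the indicator function of a bounded convex body. -/
theorem exists_lintegral_indicator_translate_sub_le {Ω : Set E} (hopen : IsOpen Ω)
    (hbdd : Bornology.IsBounded Ω) (hconv : Convex ℝ Ω) (hne : Ω.Nonempty) :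
    ∃ C : ℝ, 0 ≤ C ∧ ∀ h : E,
      ∫⁻ τ, ‖Ω.indicator (fun _ => (1 : ℂ)) (τ + h) - Ω.indicator (fun _ => (1 : ℂ)) τ‖ₑ ^ 2 ∂μ ≤
        ENNReal.ofReal (C * ‖h‖) := by
  obtain ⟨z, hz⟩ := hne
  obtain ⟨r, hr, hzr⟩ := Metric.nhds_basis_closedBall.mem_iff.mp (hopen.mem_nhds hz)
  have hfin : μ Ω ≠ ∞ := hbdd.measure_lt_top.ne
  refine ⟨2 * (2 ^ Module.finrank ℝ E / r * (μ Ω).toReal), by positivity, fun h => ?_⟩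
  have hm1 : MeasurableSet {τ | τ + h ∈ Ω ∧ τ ∉ Ω} :=
    (hopen.measurableSet.preimage (measurable_add_const h)).inter hopen.measurableSet.compl
  have hm2 : MeasurableSet {τ | τ ∈ Ω ∧ τ + h ∉ Ω} :=
    hopen.measurableSet.inter (hopen.measurableSet.preimage (measurable_add_const h)).compl
  have hsecond : μ {τ | τ ∈ Ω ∧ τ + h ∉ Ω} = μ {τ | τ + (-h) ∈ Ω ∧ τ ∉ Ω} := by
    rw [← measure_preimage_add_right μ h {τ | τ + (-h) ∈ Ω ∧ τ ∉ Ω}]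
    congr 1
    ext τ
    simp
  have hA := volume_translate_diff_le (μ := μ) hopen hbdd hconv hr hzr h
  have hB := volume_translate_diff_le (μ := μ) hopen hbdd hconv hr hzr (-h)
  rw [norm_neg] at hB
  calc ∫⁻ τ, ‖Ω.indicator (fun _ => (1 : ℂ)) (τ + h) - Ω.indicator (fun _ => (1 : ℂ)) τ‖ₑ ^ 2 ∂μ
      ≤ ∫⁻ τ, {τ | τ + h ∈ Ω ∧ τ ∉ Ω}.indicator (fun _ => (1 : ℝ≥0∞)) τ +
          {τ | τ ∈ Ω ∧ τ + h ∉ Ω}.indicator (fun _ => (1 : ℝ≥0∞)) τ ∂μ := by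
        refine lintegral_mono fun τ => ?_
        by_cases h1 : τ + h ∈ Ω <;> by_cases h2 : τ ∈ Ω <;> simp [h1, h2]
    _ = μ {τ | τ + h ∈ Ω ∧ τ ∉ Ω} + μ {τ | τ ∈ Ω ∧ τ + h ∉ Ω} := by
        rw [lintegral_add_left (measurable_const.indicator hm1), lintegral_indicator_const hm1,
          lintegral_indicator_const hm2, one_mul, one_mul]
    _ ≤ ENNReal.ofReal (2 ^ Module.finrank ℝ E * (‖h‖ / r)) * μ Ω +
        ENNReal.ofReal (2 ^ Module.finrank ℝ E * (‖h‖ / r)) * μ Ω := by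
        rw [hsecond]; exact add_le_add hA hB
    _ = _ := by
        conv_lhs => rw [← ENNReal.ofReal_toReal hfin]
        rw [← ENNReal.ofReal_mul (by positivity), ← ENNReal.ofReal_add (by positivity)
          (by positivity)]
        congr 1
        ring

end Convex

section KernelEstimates

variable {d : ℕ} {Ω : Set (Ed d × Ed d)} {M : ℝ}

theorem lintegral_lintegral_enorm_sliceFourier_sq {b : Ed d × Ed d → ℂ} (hb : Measurable b)
    {c : ℝ} (hc : ∀ m ξ, ‖b (m, ξ)‖ ≤
      (Metric.closedBall (0 : Ed d) M).indicator (fun _ => c) ξ) :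
    ∫⁻ m : Ed d, ∫⁻ t : Ed d,
        ‖∫ ξ : Ed d, Complex.exp (Complex.I * (⟪t, ξ⟫_ℝ : ℂ)) * b (m, ξ)‖ₑ ^ 2 =
      ENNReal.ofReal ((2 * Real.pi) ^ d) * ∫⁻ τ, ‖b τ‖ₑ ^ 2 := by
  have hdom : ∀ p : ℝ≥0∞,
      MemLp ((Metric.closedBall (0 : Ed d) M).indicator fun _ => c) p volume := fun p =>
    memLp_indicator_const p Metric.isClosed_closedBall.measurableSet c
      (Or.inr measure_closedBall_lt_top.ne)
  have hslice : ∀ (m : Ed d) (p : ℝ≥0∞), MemLp (fun ξ => b (m, ξ)) p volume := fun m p =>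
    (hdom p).mono' (hb.comp measurable_prodMk_left).aestronglyMeasurable
      (Eventually.of_forall fun ξ => hc m ξ)
  rw [Measure.volume_eq_prod, lintegral_prod _ (hb.enorm.pow_const 2).aemeasurable,
    ← lintegral_const_mul _ (Measurable.lintegral_prod_right' (hb.enorm.pow_const 2))]
  exact lintegral_congr fun m =>
    lintegral_enorm_fourierIntegral_sq (memLp_one_iff_integrable.mp (hslice m 1)) (hslice m 2)

/-- The Jacobian of `(x, y) ↦ ((x + y) / 2, x - y)` is one in absolute value. -/
theorem lintegral_lintegral_midpoint_sub {Φ : Ed d → Ed d → ℝ≥0∞}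
    (hΦ : Measurable fun p : Ed d × Ed d => Φ p.1 p.2) :
    ∫⁻ x, ∫⁻ y, Φ ((1 - 1 / 2 : ℝ) • x + (1 / 2 : ℝ) • y) (x - y) = ∫⁻ m, ∫⁻ t, Φ m t := by
  have h1 : Measurable fun p : Ed d × Ed d =>
      Φ ((1 - 1 / 2 : ℝ) • p.1 + (1 / 2 : ℝ) • p.2) (p.1 - p.2) :=
    hΦ.comp (f := fun p : Ed d × Ed d => ((1 - 1 / 2 : ℝ) • p.1 + (1 / 2 : ℝ) • p.2, p.1 - p.2))
      (by fun_prop)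
  have h2 : Measurable fun p : Ed d × Ed d => Φ (p.1 + (1 / 2 : ℝ) • p.2) p.2 :=
    hΦ.comp (f := fun p : Ed d × Ed d => (p.1 + (1 / 2 : ℝ) • p.2, p.2)) (by fun_prop)
  rw [lintegral_lintegral_swap h1.aemeasurable]
  calc ∫⁻ y, ∫⁻ x, Φ ((1 - 1 / 2 : ℝ) • x + (1 / 2 : ℝ) • y) (x - y)
      = ∫⁻ y, ∫⁻ t, Φ (y + (1 / 2 : ℝ) • t) t := by
        refine lintegral_congr fun y => ?_
        rw [← lintegral_add_right_eq_self _ y]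
        refine lintegral_congr fun t => ?_
        rw [add_sub_cancel_right]
        congr 1
        module
    _ = ∫⁻ t, ∫⁻ y, Φ (y + (1 / 2 : ℝ) • t) t := lintegral_lintegral_swap h2.aemeasurable
    _ = ∫⁻ t, ∫⁻ m, Φ m t := by
        refine lintegral_congr fun t => ?_
        exact lintegral_add_right_eq_self (fun m => Φ m t) _
    _ = ∫⁻ m, ∫⁻ t, Φ m t := (lintegral_lintegral_swap hΦ.aemeasurable).symm

theorem integrable_exp_mul_indicator (hΩ : MeasurableSet Ω) (hM : ∀ τ ∈ Ω, ‖τ‖ ≤ M)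
    (m t : Ed d) :
    Integrable fun ξ : Ed d => Complex.exp (Complex.I * (⟪t, ξ⟫_ℝ : ℂ)) *
      Ω.indicator (fun _ => (1 : ℂ)) (m, ξ) := by
  refine (integrable_indicator_closedBall d M).mono' ?_ (Eventually.of_forall fun ξ => ?_)
  · refine (Measurable.mul (Continuous.measurable (by fun_prop)) ?_).aestronglyMeasurable
    exact (measurable_const.indicator hΩ).comp (by fun_prop)
  · rw [norm_mul, norm_exp_I_mul_ofReal, one_mul]
    exact norm_indicator_le hM m ξ

theorem sliceFourier_sub_translate (hΩ : MeasurableSet Ω) (hM : ∀ τ ∈ Ω, ‖τ‖ ≤ M)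
    (m t η : Ed d) :
    sliceFourier Ω m t - sliceFourier Ω (m + (1 / 2 : ℝ) • η) (t - η) =
      ∫ ξ : Ed d, Complex.exp (Complex.I * (⟪t, ξ⟫_ℝ : ℂ)) *
        (Ω.indicator (fun _ => (1 : ℂ)) (m, ξ) - Complex.exp (Complex.I * (⟪-η, ξ⟫_ℝ : ℂ)) *
          Ω.indicator (fun _ => (1 : ℂ)) ((m, ξ) + ((1 / 2 : ℝ) • η, 0))) := by
  rw [sliceFourier, sliceFourier, ← integral_sub (integrable_exp_mul_indicator hΩ hM _ _)
    (integrable_exp_mul_indicator hΩ hM _ _)]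
  congr 1
  ext ξ
  rw [sub_eq_add_neg t η, inner_add_left, ofReal_add, mul_add, Complex.exp_add, mul_sub, mul_assoc]
  simp

theorem exp_sub_one_mul_sliceFourier (hΩ : MeasurableSet Ω) (hM : ∀ τ ∈ Ω, ‖τ‖ ≤ M)
    (m t η : Ed d) :
    (Complex.exp (Complex.I * (⟪t, η⟫_ℝ : ℂ)) - 1) * sliceFourier Ω m t =
      ∫ ξ : Ed d, Complex.exp (Complex.I * (⟪t, ξ⟫_ℝ : ℂ)) *
        (Ω.indicator (fun _ => (1 : ℂ)) ((m, ξ) + (0, -η)) -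
          Ω.indicator (fun _ => (1 : ℂ)) (m, ξ)) := by
  have hs : ∀ ξ : Ed d, Complex.exp (Complex.I * (⟪t, ξ⟫_ℝ : ℂ)) *
      Ω.indicator (fun _ => (1 : ℂ)) ((m, ξ) + (0, -η)) =
      Complex.exp (Complex.I * (⟪t, η⟫_ℝ : ℂ)) *
      (Complex.exp (Complex.I * (⟪t, ξ - η⟫_ℝ : ℂ)) *
        Ω.indicator (fun _ => (1 : ℂ)) (m, ξ - η)) := fun ξ => by
    rw [← mul_assoc, ← Complex.exp_add, ← mul_add, ← ofReal_add, ← inner_add_right,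
      add_sub_cancel]
    simp [sub_eq_add_neg]
  have h1 := integrable_exp_mul_indicator hΩ hM m t
  simp only [mul_sub, hs]
  rw [integral_sub ((h1.comp_sub_right η).const_mul _) h1, integral_const_mul,
    integral_sub_right_eq_self (fun ξ : Ed d => Complex.exp (Complex.I * (⟪t, ξ⟫_ℝ : ℂ)) *
      Ω.indicator (fun _ => (1 : ℂ)) (m, ξ)) η, sliceFourier]
  ring

theorem enorm_add_sq_le (a b : ℂ) : ‖a + b‖ₑ ^ 2 ≤ 2 * ‖a‖ₑ ^ 2 + 2 * ‖b‖ₑ ^ 2 := by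
  have h : ‖a + b‖ ^ 2 ≤ 2 * ‖a‖ ^ 2 + 2 * ‖b‖ ^ 2 := by
    have := norm_add_le a b
    nlinarith [norm_nonneg (a + b), sq_nonneg (‖a‖ - ‖b‖)]
  have h2 := ENNReal.ofReal_le_ofReal h
  rw [ENNReal.ofReal_add (by positivity) (by positivity), ENNReal.ofReal_mul (by norm_num),
    ENNReal.ofReal_mul (by norm_num)] at h2
  simpa [ENNReal.ofReal_pow] using h2

/-- The modulus of continuity in `L²` of the Weyl kernel in its second variable. -/
theorem exists_lintegral_weylKernel_translate_sub_le (hΩ : MeasurableSet Ω)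
    (hM : ∀ τ ∈ Ω, ‖τ‖ ≤ M) {C : ℝ} (hC0 : 0 ≤ C)
    (hC : ∀ h : Ed d × Ed d,
      ∫⁻ τ, ‖Ω.indicator (fun _ => (1 : ℂ)) (τ + h) - Ω.indicator (fun _ => (1 : ℂ)) τ‖ₑ ^ 2 ≤
        ENNReal.ofReal (C * ‖h‖)) :
    ∃ C' : ℝ, 0 ≤ C' ∧ ∀ η : Ed d, ‖η‖ ≤ d →
      ∫⁻ x, ∫⁻ y, ‖weylKernel Ω x y - weylKernel Ω x (y + η)‖ₑ ^ 2 ≤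
        ENNReal.ofReal (C' * ‖η‖) := by
  have hfin : volume Ω ≠ ∞ := by
    refine (Bornology.IsBounded.measure_lt_top ?_).ne
    exact isBounded_iff_forall_norm_le.mpr ⟨M, hM⟩
  obtain ⟨V, hV0, hV⟩ : ∃ V : ℝ, 0 ≤ V ∧ volume Ω = ENNReal.ofReal V :=
    ⟨_, ENNReal.toReal_nonneg, (ENNReal.ofReal_toReal hfin).symm⟩
  set c : ℝ := (2 * Real.pi) ^ (-(d : ℝ)) with hc
  have hc0 : 0 ≤ c := by positivity
  set K : ℝ := c ^ 2 * (2 * Real.pi) ^ d with hK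
  have hK0 : 0 ≤ K := by positivity
  refine ⟨K * (2 * C + 2 * (d * M ^ 2 * V)), by positivity, fun η hη => ?_⟩
  set b : Ed d × Ed d → ℂ := fun τ => Ω.indicator (fun _ => (1 : ℂ)) τ -
    Complex.exp (Complex.I * (⟪-η, τ.2⟫_ℝ : ℂ)) *
      Ω.indicator (fun _ => (1 : ℂ)) (τ + ((1 / 2 : ℝ) • η, 0)) with hb
  have hind : Measurable (Ω.indicator fun _ => (1 : ℂ)) := measurable_const.indicator hΩ
  have hbm : Measurable b := by
    refine hind.sub (Measurable.mul (Continuous.measurable (by fun_prop)) ?_)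
    exact hind.comp (measurable_add_const _)
  have hbb : ∀ m ξ, ‖b (m, ξ)‖ ≤
      (Metric.closedBall (0 : Ed d) M).indicator (fun _ => (2 : ℝ)) ξ := fun m ξ => by
    have h1 := norm_indicator_le hM m ξ
    have h2 := norm_indicator_le hM (m + (1 / 2 : ℝ) • η) ξ
    have h3 : (Metric.closedBall (0 : Ed d) M).indicator (fun _ => (2 : ℝ)) ξ =
        (Metric.closedBall (0 : Ed d) M).indicator (fun _ => (1 : ℝ)) ξ +
        (Metric.closedBall (0 : Ed d) M).indicator (fun _ => (1 : ℝ)) ξ := by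
      by_cases h : ξ ∈ Metric.closedBall (0 : Ed d) M
      · rw [Set.indicator_of_mem h, Set.indicator_of_mem h]; norm_num
      · rw [Set.indicator_of_notMem h, Set.indicator_of_notMem h]; norm_num
    rw [h3]
    refine (norm_sub_le _ _).trans (add_le_add h1 ?_)
    rw [norm_mul, norm_exp_I_mul_ofReal, one_mul]
    simpa using h2
  have hbint : ∫⁻ τ, ‖b τ‖ₑ ^ 2 ≤
      ENNReal.ofReal ((2 * C + 2 * (d * M ^ 2 * V)) * ‖η‖) := by
    have hpt : ∀ τ, ‖b τ‖ₑ ^ 2 ≤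
        2 * ‖Ω.indicator (fun _ => (1 : ℂ)) (τ + ((1 / 2 : ℝ) • η, 0)) -
          Ω.indicator (fun _ => (1 : ℂ)) τ‖ₑ ^ 2 +
        2 * ((fun τ => τ + ((1 / 2 : ℝ) • η, (0 : Ed d))) ⁻¹' Ω).indicator
          (fun _ => ENNReal.ofReal (‖η‖ ^ 2 * M ^ 2)) τ := fun τ => by
      have h1 : b τ = (Ω.indicator (fun _ => (1 : ℂ)) τ -
          Ω.indicator (fun _ => (1 : ℂ)) (τ + ((1 / 2 : ℝ) • η, 0))) +
          (1 - Complex.exp (Complex.I * (⟪-η, τ.2⟫_ℝ : ℂ))) *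
            Ω.indicator (fun _ => (1 : ℂ)) (τ + ((1 / 2 : ℝ) • η, 0)) := by
        rw [hb]; ring
      rw [h1]
      refine (enorm_add_sq_le _ _).trans ?_
      rw [enorm_sub_rev]
      gcongr
      by_cases h : τ + ((1 / 2 : ℝ) • η, (0 : Ed d)) ∈ Ω
      · rw [Set.indicator_of_mem h, Set.indicator_of_mem (by exact h), mul_one, ← ofReal_norm,
          ← ENNReal.ofReal_pow (norm_nonneg _)]
        refine ENNReal.ofReal_le_ofReal ?_
        rw [← mul_pow, norm_sub_rev]
        refine pow_le_pow_left₀ (norm_nonneg _) ?_ 2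
        refine Real.norm_exp_I_mul_ofReal_sub_one_le.trans ?_
        refine (norm_inner_le_norm _ _).trans ?_
        rw [norm_neg]
        have h4 := (norm_snd_le (τ + ((1 / 2 : ℝ) • η, (0 : Ed d)))).trans (hM _ h)
        simp only [Prod.snd_add, add_zero] at h4
        gcongr
      · rw [Set.indicator_of_notMem h, mul_zero]
        simp
    refine (lintegral_mono hpt).trans ?_
    have hmA : Measurable fun τ : Ed d × Ed d =>
        2 * ‖Ω.indicator (fun _ => (1 : ℂ)) (τ + ((1 / 2 : ℝ) • η, 0)) -
          Ω.indicator (fun _ => (1 : ℂ)) τ‖ₑ ^ 2 :=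
      ((((hind.comp (measurable_add_const _)).sub hind).enorm).pow_const 2).const_mul 2
    have hmP : MeasurableSet ((fun τ => τ + ((1 / 2 : ℝ) • η, (0 : Ed d))) ⁻¹' Ω) :=
      measurable_add_const _ hΩ
    have hvol : volume ((fun τ => τ + ((1 / 2 : ℝ) • η, (0 : Ed d))) ⁻¹' Ω) = volume Ω := by
      rw [Measure.volume_eq_prod]
      exact measure_preimage_add_right _ _ _
    rw [lintegral_add_left hmA, lintegral_const_mul' _ _ (by norm_num),
      lintegral_const_mul' _ _ (by norm_num), lintegral_indicator_const hmP,
      hvol, hV,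
      ← ENNReal.ofReal_mul (by positivity)]
    have h2 : ∀ a : ℝ, 2 * ENNReal.ofReal a = ENNReal.ofReal (2 * a) := fun a => by
      rw [ENNReal.ofReal_mul (by norm_num), ENNReal.ofReal_ofNat]
    have h5 : ‖((1 / 2 : ℝ) • η, (0 : Ed d))‖ ≤ ‖η‖ := by
      rw [Prod.norm_mk, norm_zero, norm_smul]
      norm_num
      linarith [norm_nonneg η]
    have h6 := (hC ((1 / 2 : ℝ) • η, 0)).trans
      (ENNReal.ofReal_le_ofReal (mul_le_mul_of_nonneg_left h5 hC0))
    have h7 : ‖η‖ ^ 2 * M ^ 2 * V ≤ d * M ^ 2 * V * ‖η‖ := by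
      have h8 : ‖η‖ ^ 2 ≤ d * ‖η‖ := by nlinarith [norm_nonneg η]
      calc _ ≤ (d * ‖η‖) * M ^ 2 * V := by gcongr
        _ = _ := by ring
    calc _ ≤ 2 * ENNReal.ofReal (C * ‖η‖) +
          2 * ENNReal.ofReal (d * M ^ 2 * V * ‖η‖) := by
          refine add_le_add (mul_le_mul_right h6 2)
            (mul_le_mul_right (ENNReal.ofReal_le_ofReal h7) 2)
      _ = _ := by
          rw [h2, h2, ← ENNReal.ofReal_add (by positivity) (by positivity)]
          congr 1
          ring
  have hΦ : Measurable fun p : Ed d × Ed d => ENNReal.ofReal (c ^ 2) *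
      ‖sliceFourier Ω p.1 p.2 - sliceFourier Ω (p.1 + (1 / 2 : ℝ) • η) (p.2 - η)‖ₑ ^ 2 := by
    refine (((measurable_sliceFourier hΩ).sub ?_).enorm.pow_const 2).const_mul _
    exact (measurable_sliceFourier hΩ).comp
      (f := fun p : Ed d × Ed d => (p.1 + (1 / 2 : ℝ) • η, p.2 - η)) (by fun_prop)
  calc ∫⁻ x, ∫⁻ y, ‖weylKernel Ω x y - weylKernel Ω x (y + η)‖ₑ ^ 2
      = ∫⁻ m, ∫⁻ t, ENNReal.ofReal (c ^ 2) *
          ‖sliceFourier Ω m t - sliceFourier Ω (m + (1 / 2 : ℝ) • η) (t - η)‖ₑ ^ 2 := by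
        rw [← lintegral_lintegral_midpoint_sub (Φ := fun m t => ENNReal.ofReal (c ^ 2) *
          ‖sliceFourier Ω m t - sliceFourier Ω (m + (1 / 2 : ℝ) • η) (t - η)‖ₑ ^ 2) hΦ]
        refine lintegral_congr fun x => lintegral_congr fun y => ?_
        rw [weylKernel, weylKernel, ← mul_sub, enorm_mul, mul_pow, ← hc]
        congr 1
        · rw [← ofReal_norm, norm_real, Real.norm_of_nonneg hc0, ENNReal.ofReal_pow hc0]
        · rw [smul_add, add_assoc, sub_sub]
    _ = ENNReal.ofReal (c ^ 2) * ∫⁻ m, ∫⁻ t,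
          ‖∫ ξ : Ed d, Complex.exp (Complex.I * (⟪t, ξ⟫_ℝ : ℂ)) * b (m, ξ)‖ₑ ^ 2 := by
        simp only [lintegral_const_mul' _ _ ENNReal.ofReal_ne_top]
        simp only [sliceFourier_sub_translate hΩ hM, hb]
    _ = ENNReal.ofReal K * ∫⁻ τ, ‖b τ‖ₑ ^ 2 := by
        rw [lintegral_lintegral_enorm_sliceFourier_sq hbm hbb, ← mul_assoc,
          ← ENNReal.ofReal_mul (by positivity)]
    _ ≤ ENNReal.ofReal K *
          ENNReal.ofReal ((2 * C + 2 * (d * M ^ 2 * V)) * ‖η‖) := by gcongr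
    _ = _ := by rw [← ENNReal.ofReal_mul hK0, ← mul_assoc]

theorem lintegral_exp_sub_one_mul_sliceFourier_le (hΩ : MeasurableSet Ω)
    (hM : ∀ τ ∈ Ω, ‖τ‖ ≤ M) {C : ℝ}
    (hC : ∀ h : Ed d × Ed d,
      ∫⁻ τ, ‖Ω.indicator (fun _ => (1 : ℂ)) (τ + h) - Ω.indicator (fun _ => (1 : ℂ)) τ‖ₑ ^ 2 ≤
        ENNReal.ofReal (C * ‖h‖)) (η : Ed d) :
    ∫⁻ m, ∫⁻ t, ‖(Complex.exp (Complex.I * (⟪t, η⟫_ℝ : ℂ)) - 1) * sliceFourier Ω m t‖ₑ ^ 2 ≤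
      ENNReal.ofReal ((2 * Real.pi) ^ d) * ENNReal.ofReal (C * ‖η‖) := by
  have hind : Measurable (Ω.indicator fun _ => (1 : ℂ)) := measurable_const.indicator hΩ
  set b : Ed d × Ed d → ℂ := fun τ => Ω.indicator (fun _ => (1 : ℂ)) (τ + (0, -η)) -
    Ω.indicator (fun _ => (1 : ℂ)) τ with hb
  have hbm : Measurable b := (hind.comp (measurable_add_const _)).sub hind
  have hM' : ∀ τ ∈ Ω, ‖τ‖ ≤ M + ‖η‖ := fun τ hτ => (hM τ hτ).trans (by simp)
  have hle1 : ∀ τ, ‖Ω.indicator (fun _ => (1 : ℂ)) τ‖ ≤ 1 := fun τ => by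
    by_cases h : τ ∈ Ω <;> simp [h]
  have hbb : ∀ m ξ, ‖b (m, ξ)‖ ≤
      (Metric.closedBall (0 : Ed d) (M + ‖η‖)).indicator (fun _ => (2 : ℝ)) ξ := fun m ξ => by
    by_cases h : ξ ∈ Metric.closedBall (0 : Ed d) (M + ‖η‖)
    · rw [Set.indicator_of_mem h]
      exact (norm_sub_le _ _).trans ((add_le_add (hle1 _) (hle1 _)).trans (by norm_num))
    · rw [Set.indicator_of_notMem h, hb]
      rw [mem_closedBall_zero_iff, not_le] at h
      have h1 : (m, ξ) ∉ Ω := fun hm => by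
        have := (norm_snd_le (m, ξ)).trans (hM' _ hm)
        exact absurd this (not_le.mpr h)
      have h2 : (m, ξ) + (0, -η) ∉ Ω := fun hm => by
        have h3 := (norm_snd_le _).trans (hM _ hm)
        simp only [Prod.snd_add] at h3
        have h4 := norm_sub_le (ξ + -η) (-η)
        rw [add_sub_cancel_right, norm_neg] at h4
        linarith
      simp only [Set.indicator_of_notMem h1, Set.indicator_of_notMem h2, sub_zero, norm_zero,
        le_refl]
  simp only [exp_sub_one_mul_sliceFourier hΩ hM]
  rw [lintegral_lintegral_enorm_sliceFourier_sq hbm hbb]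
  gcongr
  refine (hC (0, -η)).trans_eq ?_
  rw [Prod.norm_mk, norm_zero, norm_neg, max_eq_right (norm_nonneg η)]

end KernelEstimates

section Tail

variable {d : ℕ} {Ω : Set (Ed d × Ed d)} {M : ℝ}

theorem norm_exp_I_mul_ofReal_sub_one_sq (x : ℝ) :
    ‖Complex.exp (Complex.I * (x : ℂ)) - 1‖ ^ 2 = 2 - 2 * Real.cos x := by
  rw [Complex.norm_exp_I_mul_ofReal_sub_one, Real.norm_eq_abs, sq_abs, mul_pow,
    Real.sin_sq_eq_half_sub]
  ring_nf

theorem ofReal_le_lintegral_exp_sub_one {r τ : ℝ} (hr : 0 < r) (hτ : r ≤ |τ|) :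
    ENNReal.ofReal (2 / r) ≤ ∫⁻ σ in Set.Ioc 0 (2 / r),
      ‖Complex.exp (Complex.I * ((σ * τ : ℝ) : ℂ)) - 1‖ₑ ^ 2 := by
  have hs : 0 < 2 / r := by positivity
  have hτ0 : τ ≠ 0 := abs_pos.mp (hr.trans_le hτ)
  have hcont : Continuous fun σ : ℝ => 2 - 2 * Real.cos (σ * τ) := by fun_prop
  have h1 : ∀ σ : ℝ, ‖Complex.exp (Complex.I * ((σ * τ : ℝ) : ℂ)) - 1‖ₑ ^ 2 =
      ENNReal.ofReal (2 - 2 * Real.cos (σ * τ)) := fun σ => by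
    rw [← norm_exp_I_mul_ofReal_sub_one_sq, ENNReal.ofReal_pow (norm_nonneg _), ofReal_norm]
  simp only [h1]
  rw [← ofReal_integral_eq_lintegral_ofReal hcont.integrableOn_Ioc
    (Eventually.of_forall fun σ => by
      simp only [Pi.zero_apply]; linarith [Real.cos_le_one (σ * τ)]),
    ← intervalIntegral.integral_of_le hs.le]
  refine ENNReal.ofReal_le_ofReal ?_
  have h2 : ∫ σ in (0 : ℝ)..(2 / r), (2 - 2 * Real.cos (σ * τ)) =
      2 * (2 / r) - 2 * (τ⁻¹ * Real.sin (2 / r * τ)) := by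
    rw [intervalIntegral.integral_sub (by simp) ((by fun_prop : Continuous fun σ : ℝ =>
      2 * Real.cos (σ * τ)).intervalIntegrable _ _), intervalIntegral.integral_const_mul,
      intervalIntegral.integral_comp_mul_right _ hτ0, integral_cos]
    simp [mul_comm]
  rw [h2]
  have h3 : τ⁻¹ * Real.sin (2 / r * τ) ≤ r⁻¹ := by
    refine (le_abs_self _).trans ?_
    rw [abs_mul, abs_inv]
    calc |τ|⁻¹ * |Real.sin (2 / r * τ)| ≤ r⁻¹ * 1 := by
          gcongr
          exact Real.abs_sin_le_one _
      _ = r⁻¹ := mul_one _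
  rw [div_eq_mul_inv] at h3 ⊢
  linarith

theorem lintegral_exp_sub_one_coord_mul_sliceFourier_le (hΩ : MeasurableSet Ω)
    (hM : ∀ τ ∈ Ω, ‖τ‖ ≤ M) {C : ℝ}
    (hC : ∀ h : Ed d × Ed d,
      ∫⁻ τ, ‖Ω.indicator (fun _ => (1 : ℂ)) (τ + h) - Ω.indicator (fun _ => (1 : ℂ)) τ‖ₑ ^ 2 ≤
        ENNReal.ofReal (C * ‖h‖)) {σ : ℝ} (hσ : 0 ≤ σ) (j : Fin d) :
    ∫⁻ m : Ed d, ∫⁻ t : Ed d, ‖(Complex.exp (Complex.I * ((σ * t j : ℝ) : ℂ)) - 1) *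
        sliceFourier Ω m t‖ₑ ^ 2 ≤
      ENNReal.ofReal ((2 * Real.pi) ^ d) * ENNReal.ofReal (C * σ) := by
  have h1 : ∀ t : Ed d, ⟪t, EuclideanSpace.single j σ⟫_ℝ = σ * t j := fun t => by
    rw [EuclideanSpace.inner_single_right]
    rfl
  have h2 := lintegral_exp_sub_one_mul_sliceFourier_le hΩ hM hC (EuclideanSpace.single j σ)
  simp only [h1] at h2
  rwa [PiLp.norm_single, Real.norm_of_nonneg hσ] at h2

theorem lintegral_indicator_abs_coord_sliceFourier_le (hΩ : MeasurableSet Ω)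
    (hM : ∀ τ ∈ Ω, ‖τ‖ ≤ M) {C : ℝ} (hC0 : 0 ≤ C)
    (hC : ∀ h : Ed d × Ed d,
      ∫⁻ τ, ‖Ω.indicator (fun _ => (1 : ℂ)) (τ + h) - Ω.indicator (fun _ => (1 : ℂ)) τ‖ₑ ^ 2 ≤
        ENNReal.ofReal (C * ‖h‖)) {r : ℝ} (hr : 0 < r) (j : Fin d) :
    ∫⁻ m : Ed d, ∫⁻ t : Ed d,
        {t : Ed d | r ≤ |t j|}.indicator (fun t => ‖sliceFourier Ω m t‖ₑ ^ 2) t ≤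
      ENNReal.ofReal ((2 * Real.pi) ^ d) * ENNReal.ofReal (C * (2 / r)) := by
  set s : ℝ := 2 / r with hs
  have hs0 : 0 < s := by positivity
  have hsF := (measurable_sliceFourier hΩ).enorm.pow_const 2
  have hG : Measurable fun q : (Ed d × Ed d) × ℝ =>
      ‖(Complex.exp (Complex.I * ((q.2 * q.1.2 j : ℝ) : ℂ)) - 1) *
        sliceFourier Ω q.1.1 q.1.2‖ₑ ^ 2 := by
    refine (Measurable.mul (Continuous.measurable (by fun_prop)) ?_).enorm.pow_const 2
    exact (measurable_sliceFourier hΩ).comp measurable_fst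
  have hpt : ∀ p : Ed d × Ed d,
      ENNReal.ofReal s *
        {t : Ed d | r ≤ |t j|}.indicator (fun t => ‖sliceFourier Ω p.1 t‖ₑ ^ 2) p.2 ≤
      ∫⁻ σ in Set.Ioc 0 s, ‖(Complex.exp (Complex.I * ((σ * p.2 j : ℝ) : ℂ)) - 1) *
        sliceFourier Ω p.1 p.2‖ₑ ^ 2 := fun p => by
    by_cases h : r ≤ |p.2 j|
    · rw [Set.indicator_of_mem (by exact h)]
      simp only [enorm_mul, mul_pow]
      rw [lintegral_mul_const' _ _ (by finiteness)]
      gcongr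
      exact ofReal_le_lintegral_exp_sub_one hr h
    · rw [Set.indicator_of_notMem (by exact h), mul_zero]
      exact zero_le
  have hind : Measurable fun p : Ed d × Ed d =>
      {t : Ed d | r ≤ |t j|}.indicator (fun t => ‖sliceFourier Ω p.1 t‖ₑ ^ 2) p.2 := by
    have hset : MeasurableSet {p : Ed d × Ed d | r ≤ |p.2 j|} :=
      measurableSet_le measurable_const (Measurable.abs (by fun_prop))
    exact hsF.indicator hset
  rw [← ENNReal.mul_le_mul_iff_right (a := ENNReal.ofReal s) (by simpa using hs0) (by simp)]
  calc ENNReal.ofReal s * ∫⁻ m : Ed d, ∫⁻ t : Ed d,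
        {t : Ed d | r ≤ |t j|}.indicator (fun t => ‖sliceFourier Ω m t‖ₑ ^ 2) t
      = ∫⁻ p : Ed d × Ed d, ENNReal.ofReal s *
        {t : Ed d | r ≤ |t j|}.indicator (fun t => ‖sliceFourier Ω p.1 t‖ₑ ^ 2) p.2 := by
        rw [lintegral_const_mul _ hind, Measure.volume_eq_prod, lintegral_prod _ hind.aemeasurable]
    _ ≤ ∫⁻ p : Ed d × Ed d, ∫⁻ σ in Set.Ioc 0 s,
        ‖(Complex.exp (Complex.I * ((σ * p.2 j : ℝ) : ℂ)) - 1) *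
          sliceFourier Ω p.1 p.2‖ₑ ^ 2 := lintegral_mono hpt
    _ = ∫⁻ σ in Set.Ioc 0 s, ∫⁻ p : Ed d × Ed d,
        ‖(Complex.exp (Complex.I * ((σ * p.2 j : ℝ) : ℂ)) - 1) *
          sliceFourier Ω p.1 p.2‖ₑ ^ 2 := lintegral_lintegral_swap hG.aemeasurable
    _ ≤ ∫⁻ σ in Set.Ioc 0 s,
        ENNReal.ofReal ((2 * Real.pi) ^ d) * ENNReal.ofReal (C * s) := by
        refine setLIntegral_mono' measurableSet_Ioc fun σ hσ => ?_
        have h1 : Measurable fun p : Ed d × Ed d =>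
            ‖(Complex.exp (Complex.I * ((σ * p.2 j : ℝ) : ℂ)) - 1) *
              sliceFourier Ω p.1 p.2‖ₑ ^ 2 := by
          refine (Measurable.mul (Continuous.measurable (by fun_prop)) ?_).enorm.pow_const 2
          exact measurable_sliceFourier hΩ
        rw [Measure.volume_eq_prod, lintegral_prod _ h1.aemeasurable]
        have h2 := lintegral_exp_sub_one_coord_mul_sliceFourier_le hΩ hM hC hσ.1.le j
        exact h2.trans (mul_le_mul_right (ENNReal.ofReal_le_ofReal
          (mul_le_mul_of_nonneg_left hσ.2 hC0)) _)
    _ = _ := by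
        rw [setLIntegral_const, Real.volume_Ioc, sub_zero, mul_comm]

/-- The mass of the Weyl kernel away from the part of space covered by the grid. -/
theorem lintegral_weylKernel_notMem_gridCells_le (hΩ : MeasurableSet Ω)
    (hM : ∀ τ ∈ Ω, ‖τ‖ ≤ M) {C : ℝ} (hC0 : 0 ≤ C)
    (hC : ∀ h : Ed d × Ed d,
      ∫⁻ τ, ‖Ω.indicator (fun _ => (1 : ℂ)) (τ + h) - Ω.indicator (fun _ => (1 : ℂ)) τ‖ₑ ^ 2 ≤
        ENNReal.ofReal (C * ‖h‖)) {n : ℕ} (hn : 0 < n) (hMn : 2 * M ≤ n) :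
    ∫⁻ x, ∫⁻ y in {y : Ed d | gridIndex n y ∉ gridCells d n}, ‖weylKernel Ω x y‖ₑ ^ 2 ≤
      ENNReal.ofReal (((2 * Real.pi) ^ (-(d : ℝ))) ^ 2 *
        (d * ((2 * Real.pi) ^ d * (C * 2))) / n) := by
  have hn' : (0 : ℝ) < n := by exact_mod_cast hn
  set c : ℝ := (2 * Real.pi) ^ (-(d : ℝ)) with hc
  have hc0 : 0 ≤ c := by positivity
  set Φ : Fin d → Ed d → Ed d → ℝ≥0∞ := fun j m t =>
    {t : Ed d | (n : ℝ) ≤ |t j|}.indicator (fun t => ‖sliceFourier Ω m t‖ₑ ^ 2) t with hΦdef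
  have hΦ : ∀ j, Measurable fun p : Ed d × Ed d => Φ j p.1 p.2 := fun j => by
    have hset : MeasurableSet {p : Ed d × Ed d | (n : ℝ) ≤ |p.2 j|} :=
      measurableSet_le measurable_const (Measurable.abs (by fun_prop))
    exact ((measurable_sliceFourier hΩ).enorm.pow_const 2).indicator hset
  have hS : MeasurableSet {y : Ed d | gridIndex n y ∉ gridCells d n} :=
    measurable_gridIndex n (MeasurableSet.of_discrete (s := {κ | κ ∉ gridCells d n}))
  have hpt : ∀ x y : Ed d, {y : Ed d | gridIndex n y ∉ gridCells d n}.indicator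
      (fun y => ‖weylKernel Ω x y‖ₑ ^ 2) y ≤ ENNReal.ofReal (c ^ 2) *
        ∑ j, Φ j ((1 - 1 / 2 : ℝ) • x + (1 / 2 : ℝ) • y) (x - y) := fun x y => by
    by_cases hy : gridIndex n y ∉ gridCells d n
    swap
    · rw [Set.indicator_of_notMem (by exact hy)]
      exact zero_le
    rw [Set.indicator_of_mem (by exact hy), weylKernel, enorm_mul, mul_pow, ← hc,
      ← ofReal_norm (c : ℂ), norm_real, Real.norm_of_nonneg hc0, ENNReal.ofReal_pow hc0]
    gcongr
    set m := (1 - 1 / 2 : ℝ) • x + (1 / 2 : ℝ) • y with hm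
    by_cases hmM : M < ‖m‖
    · simp [sliceFourier_eq_zero hM hmM]
    obtain ⟨j, hj⟩ : ∃ j, (n : ℝ) ≤ |y j| := by
      by_contra! hlt
      refine hy ?_
      simp only [gridCells, gridIndex, Fintype.mem_piFinset, Finset.mem_Ico]
      intro j
      obtain ⟨h1, h2⟩ := abs_lt.mp (hlt j)
      refine ⟨Int.le_floor.mpr ?_, Int.floor_lt.mpr ?_⟩ <;> push_cast <;> nlinarith
    have hmj : |m j| ≤ M := by
      rw [← Real.norm_eq_abs]
      exact (PiLp.norm_apply_le m j).trans (not_lt.mp hmM)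
    have htj : (x - y) j = 2 * m j - 2 * y j := by
      simp only [hm, PiLp.sub_apply, PiLp.add_apply, PiLp.smul_apply, smul_eq_mul]
      ring
    have hnt : (n : ℝ) ≤ |(x - y) j| := by
      rw [htj, abs_sub_comm]
      refine le_trans ?_ (abs_sub_abs_le_abs_sub _ _)
      rw [abs_mul, abs_mul, abs_two]
      linarith
    calc ‖sliceFourier Ω m (x - y)‖ₑ ^ 2 = Φ j m (x - y) :=
          (Set.indicator_of_mem (s := {t : Ed d | (n : ℝ) ≤ |t j|}) hnt
            fun t => ‖sliceFourier Ω m t‖ₑ ^ 2).symm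
      _ ≤ _ := Finset.single_le_sum (f := fun j => Φ j m (x - y)) (fun _ _ => zero_le)
          (Finset.mem_univ j)
  have hsum : Measurable fun p : Ed d × Ed d => ENNReal.ofReal (c ^ 2) * ∑ j, Φ j p.1 p.2 :=
    (Finset.measurable_sum _ fun j _ => hΦ j).const_mul _
  calc ∫⁻ x, ∫⁻ y in {y : Ed d | gridIndex n y ∉ gridCells d n}, ‖weylKernel Ω x y‖ₑ ^ 2
      ≤ ∫⁻ x, ∫⁻ y, ENNReal.ofReal (c ^ 2) *
        ∑ j, Φ j ((1 - 1 / 2 : ℝ) • x + (1 / 2 : ℝ) • y) (x - y) := by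
        refine lintegral_mono fun x => ?_
        rw [← lintegral_indicator hS]
        exact lintegral_mono (hpt x)
    _ = ∫⁻ m, ∫⁻ t, ENNReal.ofReal (c ^ 2) * ∑ j, Φ j m t :=
        lintegral_lintegral_midpoint_sub (Φ := fun m t => ENNReal.ofReal (c ^ 2) * ∑ j, Φ j m t)
          hsum
    _ = ENNReal.ofReal (c ^ 2) * ∑ j, ∫⁻ m, ∫⁻ t, Φ j m t := by
        simp only [lintegral_const_mul' _ _ ENNReal.ofReal_ne_top]
        congr 1
        rw [← lintegral_finsetSum _ fun j _ => Measurable.lintegral_prod_right' (hΦ j)]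
        refine lintegral_congr fun m => ?_
        exact lintegral_finsetSum _ fun j _ => (hΦ j).comp measurable_prodMk_left
    _ ≤ ENNReal.ofReal (c ^ 2) * ∑ _j : Fin d,
        ENNReal.ofReal ((2 * Real.pi) ^ d) * ENNReal.ofReal (C * (2 / n)) := by
        gcongr with j
        exact lintegral_indicator_abs_coord_sliceFourier_le hΩ hM hC0 hC hn' j
    _ = _ := by
        rw [Finset.sum_const, Finset.card_univ, Fintype.card_fin, nsmul_eq_mul,
          ← ENNReal.ofReal_natCast, ← ENNReal.ofReal_mul (by positivity),
          ← ENNReal.ofReal_mul (by positivity), ← ENNReal.ofReal_mul (by positivity)]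
        congr 1
        ring

end Tail

section HilbertSchmidt

variable {d : ℕ} {Ω : Set (Ed d × Ed d)} {M : ℝ}

theorem lintegral_weylRow_sub_starProjection_le (hΩ : MeasurableSet Ω)
    (hM : ∀ τ ∈ Ω, ‖τ‖ ≤ M) {C₁ C₂ : ℝ} (hC₁ : 0 ≤ C₁) (hC₂ : 0 ≤ C₂)
    (hmod : ∀ η : Ed d, ‖η‖ ≤ d →
      ∫⁻ x, ∫⁻ y, ‖weylKernel Ω x y - weylKernel Ω x (y + η)‖ₑ ^ 2 ≤
        ENNReal.ofReal (C₁ * ‖η‖))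
    {n : ℕ} (hn : 0 < n)
    (htail : ∫⁻ x, ∫⁻ y in {y : Ed d | gridIndex n y ∉ gridCells d n}, ‖weylKernel Ω x y‖ₑ ^ 2 ≤
      ENNReal.ofReal (C₂ / n)) :
    ∫⁻ x, ‖weylRow hΩ hM x - (gridSpace d hn).starProjection (weylRow hΩ hM x)‖ₑ ^ 2 ≤
      ENNReal.ofReal ((2 ^ d * (C₁ * d) + C₂) / n) := by
  have hn' : (1 : ℝ) ≤ n := by exact_mod_cast hn
  have hU : volume (unitCell d n) ≠ ∞ := by
    rw [volume_unitCell]; finiteness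
  have hU0 : volume (unitCell d n) ≠ 0 := by
    rw [volume_unitCell]
    refine pow_ne_zero _ ?_
    rw [Ne, ENNReal.ofReal_eq_zero, not_le]
    positivity
  have hK := measurable_weylKernel hΩ
  have hG : Measurable fun q : (Ed d × Ed d) × Ed d =>
      ‖weylKernel Ω q.1.1 q.1.2 - weylKernel Ω q.1.1 (q.1.2 + q.2)‖ₑ ^ 2 := by
    refine ((hK.comp measurable_fst).sub ?_).enorm.pow_const 2
    exact hK.comp (f := fun q : (Ed d × Ed d) × Ed d => (q.1.1, q.1.2 + q.2)) (by fun_prop)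
  have hG' : Measurable fun q : (Ed d × Ed d) × Ed d =>
      ‖weylKernel Ω q.1.1 q.2 - weylKernel Ω q.1.1 (q.2 + q.1.2)‖ₑ ^ 2 :=
    hG.comp (f := fun q : (Ed d × Ed d) × Ed d => ((q.1.1, q.2), q.1.2)) (by fun_prop)
  have hGη : Measurable fun p : Ed d × Ed d => ∫⁻ η in openCube d n,
      ‖weylKernel Ω p.1 p.2 - weylKernel Ω p.1 (p.2 + η)‖ₑ ^ 2 :=
    Measurable.lintegral_prod_right' hG
  have hGy : Measurable fun p : Ed d × Ed d => ∫⁻ y,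
      ‖weylKernel Ω p.1 y - weylKernel Ω p.1 (y + p.2)‖ₑ ^ 2 :=
    Measurable.lintegral_prod_right' hG'
  have hrow : ∀ x, volume (unitCell d n) *
      ‖weylRow hΩ hM x - (gridSpace d hn).starProjection (weylRow hΩ hM x)‖ₑ ^ 2 ≤
      (∫⁻ y, ∫⁻ η in openCube d n, ‖weylKernel Ω x y - weylKernel Ω x (y + η)‖ₑ ^ 2) +
        volume (unitCell d n) *
          ∫⁻ y in {y : Ed d | gridIndex n y ∉ gridCells d n}, ‖weylKernel Ω x y‖ₑ ^ 2 :=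
    fun x => by
      have hm : Measurable fun y => star (weylKernel Ω x y) :=
        continuous_star.measurable.comp
          (Measurable.of_uncurry_left (f := weylKernel Ω) hK)
      have h := volume_mul_enorm_sub_starProjection_sq_le (coeFn_weylRow hΩ hM x) hm hn
      have he : ∀ z : ℂ, ‖star z‖ₑ = ‖z‖ₑ := fun z => by
        rw [← ofReal_norm, norm_star, ofReal_norm]
      simpa only [← star_sub, he] using h
  have hcube : ∀ η ∈ openCube d n,
      ∫⁻ x, ∫⁻ y, ‖weylKernel Ω x y - weylKernel Ω x (y + η)‖ₑ ^ 2 ≤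
        ENNReal.ofReal (C₁ * d / n) := fun η hη => by
    have h1 : ‖η‖ ≤ d * (1 / n) := norm_le_of_forall_abs_le fun j => (hη j).le
    have h2 : (d : ℝ) * (1 / n) ≤ d := by
      rw [mul_one_div]
      exact div_le_self (Nat.cast_nonneg d) hn'
    refine (hmod η (h1.trans h2)).trans (ENNReal.ofReal_le_ofReal ?_)
    calc C₁ * ‖η‖ ≤ C₁ * (d * (1 / n)) := by gcongr
      _ = C₁ * d / n := by ring
  have hswap : ∫⁻ x, ∫⁻ y, ∫⁻ η in openCube d n,
      ‖weylKernel Ω x y - weylKernel Ω x (y + η)‖ₑ ^ 2 =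
      ∫⁻ η in openCube d n, ∫⁻ x, ∫⁻ y,
        ‖weylKernel Ω x y - weylKernel Ω x (y + η)‖ₑ ^ 2 := by
    refine Eq.trans (lintegral_congr fun x => lintegral_lintegral_swap ?_)
      (lintegral_lintegral_swap hGy.aemeasurable)
    exact (hG.comp (f := fun p : Ed d × Ed d => ((x, p.1), p.2)) (by fun_prop)).aemeasurable
  rw [← ENNReal.mul_le_mul_iff_right hU0 hU]
  calc volume (unitCell d n) *
        ∫⁻ x, ‖weylRow hΩ hM x - (gridSpace d hn).starProjection (weylRow hΩ hM x)‖ₑ ^ 2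
      = ∫⁻ x, volume (unitCell d n) *
        ‖weylRow hΩ hM x - (gridSpace d hn).starProjection (weylRow hΩ hM x)‖ₑ ^ 2 :=
        (lintegral_const_mul' _ _ hU).symm
    _ ≤ _ := lintegral_mono hrow
    _ = (∫⁻ η in openCube d n, ∫⁻ x, ∫⁻ y,
          ‖weylKernel Ω x y - weylKernel Ω x (y + η)‖ₑ ^ 2) + volume (unitCell d n) *
        ∫⁻ x, ∫⁻ y in {y : Ed d | gridIndex n y ∉ gridCells d n}, ‖weylKernel Ω x y‖ₑ ^ 2 := by
        rw [lintegral_add_left (Measurable.lintegral_prod_right' hGη),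
          lintegral_const_mul' _ _ hU, hswap]
    _ ≤ (∫⁻ _η in openCube d n, ENNReal.ofReal (C₁ * d / n)) +
        volume (unitCell d n) * ENNReal.ofReal (C₂ / n) :=
        add_le_add (setLIntegral_mono' (measurableSet_openCube d n) hcube)
          (mul_le_mul_right htail _)
    _ = _ := by
        have h2 : (2 : ℝ≥0∞) ^ d = ENNReal.ofReal (2 ^ d) := by
          rw [ENNReal.ofReal_pow (by norm_num), ENNReal.ofReal_ofNat]
        rw [setLIntegral_const, volume_openCube, ← volume_unitCell, ← mul_assoc,
          mul_comm _ (volume (unitCell d n)), ← mul_add, mul_comm _ (2 ^ d), h2,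
          ← ENNReal.ofReal_mul (by positivity), ← ENNReal.ofReal_add (by positivity)
          (by positivity)]
        congr 2
        ring

/-- The integrated squared distance of the rows of the Weyl kernel to the functions which are
constant on the cells of the grid of mesh `1 / n` decays like `1 / n`. -/
theorem exists_lintegral_weylRow_sub_starProjection_le (hopen : IsOpen Ω)
    (hconv : Convex ℝ Ω) (hne : Ω.Nonempty) (hM : ∀ τ ∈ Ω, ‖τ‖ ≤ M) :
    ∃ C : ℝ, 0 ≤ C ∧ ∃ n₀ : ℕ, ∀ n, n₀ ≤ n → ∀ hn : 0 < n,
      ∫⁻ x, ‖weylRow hopen.measurableSet hM x -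
        (gridSpace d hn).starProjection (weylRow hopen.measurableSet hM x)‖ₑ ^ 2 ≤
      ENNReal.ofReal (C / n) := by
  have hbdd : Bornology.IsBounded Ω := isBounded_iff_forall_norm_le.mpr ⟨M, hM⟩
  have : (volume : Measure (Ed d × Ed d)).IsAddHaarMeasure := by
    rw [Measure.volume_eq_prod]
    infer_instance
  obtain ⟨C, hC0, hC⟩ := exists_lintegral_indicator_translate_sub_le
    (μ := (volume : Measure (Ed d × Ed d))) hopen hbdd hconv hne
  obtain ⟨C₁, hC₁, hmod⟩ :=
    exists_lintegral_weylKernel_translate_sub_le hopen.measurableSet hM hC0 hC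
  obtain ⟨n₀, hn₀⟩ := exists_nat_ge (2 * M)
  refine ⟨_, ?_, n₀, fun n hn₀n hn => lintegral_weylRow_sub_starProjection_le hopen.measurableSet
    hM hC₁ ?_ hmod hn (lintegral_weylKernel_notMem_gridCells_le hopen.measurableSet hM hC0 hC hn
      (hn₀.trans (by exact_mod_cast hn₀n)))⟩ <;> positivity

end HilbertSchmidt

section Decay

theorem Antitone.exists_le_mul_rpow_neg {s : ℕ → ℝ} (hs : Antitone s) {d : ℕ} (hd : 0 < d)
    {L n₀ : ℕ} (hL : 0 < L) (hn₀ : 0 < n₀) {D : ℝ} (hD : 0 ≤ D)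
    (h : ∀ n, n₀ ≤ n → s (L * n ^ (2 * d)) ≤ D * (n : ℝ) ^ (-((d : ℝ) + 1 / 2))) :
    ∃ C : ℝ, ∀ k : ℕ, s k ≤ C * ((k : ℝ) + 1) ^ (-(1 / 2 : ℝ) - 1 / (4 * d)) := by
  have hd' : (0 : ℝ) < d := by exact_mod_cast hd
  have hL' : (0 : ℝ) < L := by exact_mod_cast hL
  set e : ℝ := 1 / 2 + 1 / (4 * d) with he
  have he0 : 0 < e := by positivity
  have hexp : -(1 / 2 : ℝ) - 1 / (4 * d) = -e := by rw [he]; ring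
  set C₁ : ℝ := |s 0| * ((L * n₀ ^ (2 * d) : ℕ) : ℝ) ^ e
  set C₂ : ℝ := D * (L * 2 ^ (2 * d)) ^ e
  have hC₁ : 0 ≤ C₁ := by positivity
  have hC₂ : 0 ≤ C₂ := by positivity
  refine ⟨C₁ + C₂, fun k => ?_⟩
  have hk0 : (0 : ℝ) < (k : ℝ) + 1 := by positivity
  rw [hexp, Real.rpow_neg hk0.le, ← div_eq_mul_inv, le_div_iff₀ (by positivity)]
  rcases lt_or_ge k (L * n₀ ^ (2 * d)) with hk | hk
  · have h1 : (k : ℝ) + 1 ≤ ((L * n₀ ^ (2 * d) : ℕ) : ℝ) := by exact_mod_cast hk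
    calc s k * ((k : ℝ) + 1) ^ e ≤ |s 0| * ((L * n₀ ^ (2 * d) : ℕ) : ℝ) ^ e := by
          refine mul_le_mul ((hs (Nat.zero_le k)).trans (le_abs_self _)) ?_ (by positivity)
            (abs_nonneg _)
          exact Real.rpow_le_rpow hk0.le h1 he0.le
      _ ≤ C₁ + C₂ := le_add_of_nonneg_right hC₂
  · set n := Nat.findGreatest (fun n => L * n ^ (2 * d) ≤ k) k with hn
    have hle : ∀ m, L * m ^ (2 * d) ≤ k → m ≤ k := fun m hm =>
      (Nat.le_self_pow (by omega) m).trans ((Nat.le_mul_of_pos_left _ hL).trans hm)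
    have hn₀n : n₀ ≤ n := Nat.le_findGreatest (hle n₀ hk) hk
    have hnk : L * n ^ (2 * d) ≤ k :=
      Nat.findGreatest_spec (P := fun n => L * n ^ (2 * d) ≤ k) (hle n₀ hk) hk
    have hkn : k < L * (n + 1) ^ (2 * d) := by
      by_contra! hlt
      exact absurd (Nat.le_findGreatest (P := fun n => L * n ^ (2 * d) ≤ k) (hle _ hlt) hlt)
        (by omega)
    have hn1 : 1 ≤ n := hn₀.trans_le hn₀n
    have hn0 : (0 : ℝ) < n := by exact_mod_cast hn1
    have h1 : (k : ℝ) + 1 ≤ (L * 2 ^ (2 * d)) * (n : ℝ) ^ (2 * d) := by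
      have h2 : k + 1 ≤ L * (2 * n) ^ (2 * d) :=
        hkn.trans_le (Nat.mul_le_mul_left _ (Nat.pow_le_pow_left (by omega) _))
      rw [mul_assoc, ← mul_pow]
      exact_mod_cast h2
    have h3 : ((n : ℝ) ^ (2 * d)) ^ e = (n : ℝ) ^ ((d : ℝ) + 1 / 2) := by
      rw [← Real.rpow_natCast, ← Real.rpow_mul hn0.le]
      congr 1
      rw [he]
      push_cast
      field_simp
      ring
    calc s k * ((k : ℝ) + 1) ^ e
        ≤ (D * (n : ℝ) ^ (-((d : ℝ) + 1 / 2))) *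
            ((L * 2 ^ (2 * d)) * (n : ℝ) ^ (2 * d)) ^ e := by
          refine mul_le_mul ((hs hnk).trans (h n hn₀n)) ?_ (by positivity) (by positivity)
          exact Real.rpow_le_rpow hk0.le h1 he0.le
      _ = C₂ := by
          rw [Real.mul_rpow (by positivity) (by positivity), h3, Real.rpow_neg hn0.le]
          have : (n : ℝ) ^ ((d : ℝ) + 1 / 2) ≠ 0 := (Real.rpow_pos_of_pos hn0 _).ne'
          field_simp
          rfl
      _ ≤ C₁ + C₂ := le_add_of_nonneg_left hC₁

end Decay

/-- **Proposition.** If `Ω ⊂ ℝ^{2d}` is a bounded open convex set with `C^∞` boundary of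
strictly positive curvature (expressed via a smooth defining function `g` with nonvanishing
gradient and positive definite Hessian on the tangent spaces of the boundary), then
`A_Ω = Op^w(1_Ω)` satisfies `s_k(A_Ω) ≲ k^{-1/2 - 1/(4d)}`. -/
theorem weyl_indicator_singular_values_curved
    (d : ℕ) (hd : 0 < d) (Ω : Set (Ed d × Ed d))
    (hopen : IsOpen Ω) (hbdd : Bornology.IsBounded Ω) (hconv : Convex ℝ Ω)
    (hne : Ω.Nonempty)
    (g : Ed d × Ed d → ℝ) (hg : ContDiff ℝ (⊤ : ℕ∞) g) (hΩg : Ω = {τ | g τ < 0})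
    (hgrad : ∀ τ ∈ frontier Ω, fderiv ℝ g τ ≠ 0)
    (hcurv : ∀ τ ∈ frontier Ω, ∀ v : Ed d × Ed d, v ≠ 0 → fderiv ℝ g τ v = 0 →
      0 < iteratedFDeriv ℝ 2 g τ ![v, v])
    (T : L2 d →L[ℂ] L2 d)
    (hT : IsOpT d (1 / 2) (Set.indicator Ω fun _ => (1 : ℂ)) T) :
    ∃ C : ℝ, ∀ k : ℕ,
      sVal T k ≤ C * ((k : ℝ) + 1) ^ (-(1 / 2 : ℝ) - 1 / (4 * d)) := by
  obtain ⟨M, hM⟩ := isBounded_iff_forall_norm_le.mp hbdd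
  obtain ⟨C, hC0, n₀, hC⟩ := exists_lintegral_weylRow_sub_starProjection_le hopen hconv hne hM
  refine (sVal_antitone T).exists_le_mul_rpow_neg hd (L := 2 ^ d + 1) (n₀ := n₀ + 1) (by positivity)
    n₀.succ_pos (D := √C) (Real.sqrt_nonneg C) fun n hn => ?_
  have hn0 : 0 < n := by omega
  have hn' : (0 : ℝ) < n := by exact_mod_cast hn0
  have h1 : sVal T ((2 * n ^ 2) ^ d + n ^ (2 * d)) ≤
      √((C / n) / (((n ^ (2 * d) : ℕ) : ℝ) + 1)) := by
    refine sVal_add_le_of_sum_sq_le T (gridSpace d hn0) (rank_gridSpace_le d hn0) fun v hv => ?_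
    rw [← ENNReal.ofReal_le_ofReal_iff (by positivity)]
    exact (sum_norm_sq_le_lintegral_weylRow hopen.measurableSet hM hT _ hv).trans
      (hC n (by omega) hn0)
  have h2 : (2 ^ d + 1) * n ^ (2 * d) = (2 * n ^ 2) ^ d + n ^ (2 * d) := by
    rw [mul_pow, ← pow_mul]
    ring
  rw [h2]
  refine h1.trans (Real.sqrt_le_iff.mpr ⟨by positivity, ?_⟩)
  have h3 : ((n : ℝ) ^ (-((d : ℝ) + 1 / 2))) ^ 2 = ((n : ℝ) * (n : ℝ) ^ (2 * d))⁻¹ := by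
    rw [← Real.rpow_natCast, ← Real.rpow_mul hn'.le, ← pow_succ', ← Real.rpow_natCast,
      ← Real.rpow_neg hn'.le]
    congr 1
    push_cast
    ring
  rw [mul_pow, Real.sq_sqrt hC0, h3, div_div, ← div_eq_mul_inv]
  push_cast
  gcongr
  linarith

end
end
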